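/- arXiv:2112.00306 — 4 statements merged into one kernel-verified Lean document; each statement's English description precedes it below -/
import Mathlib

section
/- (Szemerédi–Trotter, incidence form) There exists an absolute constant C > 0 such that for every finite set P of n points in ℝ² and every finite set L of m lines in ℝ², the number of incidences I(P,L) = #{(p,ℓ) ∈ P × L : p ∈ ℓ} satisfies I(P,L) ≤ C·(m^{2/3}·n^{2/3} + m + n). -/
/-- A line in `ℝ²`: a set of the form `{(x,y) : a·x + b·y = c}` with `(a,b) ≠ (0,0)`. -/
def IsLine (ℓ : Set (ℝ × ℝ)) : Prop :=
  ∃ a b c : ℝ, (a, b) ≠ (0, 0) ∧ ℓ = {p : ℝ × ℝ | a * p.1 + b * p.2 = c}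

namespace SzT

/-- slope of a segment -/
noncomputable def sl (e : (ℝ × ℝ) × (ℝ × ℝ)) : ℝ := (e.2.2 - e.1.2) / (e.2.1 - e.1.1)

/-- height of the segment at abscissa `x` -/
noncomputable def ev (e : (ℝ × ℝ) × (ℝ × ℝ)) (x : ℝ) : ℝ := e.1.2 + sl e * (x - e.1.1)

/-- slope and intercept of the supporting line -/
noncomputable def ln (e : (ℝ × ℝ) × (ℝ × ℝ)) : ℝ × ℝ := (sl e, e.1.2 - sl e * e.1.1)

lemma ev_left (e : (ℝ × ℝ) × (ℝ × ℝ)) : ev e e.1.1 = e.1.2 := by simp [ev]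

lemma ev_right (e : (ℝ × ℝ) × (ℝ × ℝ)) (h : e.1.1 < e.2.1) : ev e e.2.1 = e.2.2 := by
  have : e.2.1 - e.1.1 ≠ 0 := by linarith
  unfold ev sl
  field_simp
  ring

lemma ev_ln (e : (ℝ × ℝ) × (ℝ × ℝ)) (x : ℝ) : ev e x = (ln e).1 * x + (ln e).2 := by
  simp only [ev, ln]; ring

def NoCross (e f : (ℝ × ℝ) × (ℝ × ℝ)) : Prop :=
  ∀ x₁ x₂ : ℝ, e.1.1 ≤ x₁ → f.1.1 ≤ x₁ → x₁ < x₂ → x₂ ≤ e.2.1 → x₂ ≤ f.2.1 →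
    ev e x₁ < ev f x₁ → ev e x₂ ≤ ev f x₂

structure Wedge (V : Finset (ℝ × ℝ)) (E : Finset ((ℝ × ℝ) × (ℝ × ℝ)))
    (lo hi : (ℝ × ℝ) × (ℝ × ℝ)) (q : ℝ × ℝ) : Prop where
  lo_mem : lo ∈ E
  hi_mem : hi ∈ E
  same : lo.1 = hi.1
  slt : sl lo < sl hi
  next : ∀ f ∈ E, f.1 = lo.1 → sl lo < sl f → sl hi ≤ sl f
  q_mem : q ∈ V
  q_left : lo.1.1 < q.1
  q_lo : q.1 ≤ lo.2.1
  q_hi : q.1 ≤ hi.2.1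
  q_above : ev lo q.1 ≤ q.2
  q_below : q.2 ≤ ev hi q.1
  first : ∀ v ∈ V, lo.1.1 < v.1 → v.1 < q.1 → ev lo v.1 ≤ v.2 → v.2 ≤ ev hi v.1 → False

lemma Wedge.lt {V E lo hi q} (w : Wedge V E lo hi q) : ev lo q.1 < ev hi q.1 := by
  have h1 := w.slt
  have h2 := w.q_left
  unfold ev
  rw [← w.same]
  nlinarith

lemma eq_of_sl {V : Finset (ℝ × ℝ)} {E : Finset ((ℝ × ℝ) × (ℝ × ℝ))}
    (hE : ∀ e ∈ E, e.1 ∈ V ∧ e.2 ∈ V ∧ e.1.1 < e.2.1)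
    (hv : ∀ e ∈ E, ∀ v ∈ V, e.1.1 < v.1 → v.1 < e.2.1 → v.2 ≠ ev e v.1)
    {e f} (he : e ∈ E) (hf : f ∈ E) (h1 : e.1 = f.1) (hs : sl e = sl f) : e = f := by
  have hev : ∀ x, ev e x = ev f x := fun x => by simp [ev, h1, hs]
  obtain ⟨-, he2, he3⟩ := hE e he
  obtain ⟨-, hf2, hf3⟩ := hE f hf
  have e2 := ev_right e he3
  have f2 := ev_right f hf3
  rcases lt_trichotomy e.2.1 f.2.1 with h | h | h
  · exact absurd (by rw [← hev, e2]) (hv f hf e.2 he2 (by rw [← h1]; exact he3) h)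
  · refine Prod.ext h1 (Prod.ext h ?_)
    rw [← e2, ← f2, hev, h]
  · exact absurd (by rw [hev, f2]) (hv e he f.2 hf2 (by rw [h1]; exact hf3) h)

lemma wedge_unique_aux {V : Finset (ℝ × ℝ)} {E : Finset ((ℝ × ℝ) × (ℝ × ℝ))}
    (hE : ∀ e ∈ E, e.1 ∈ V ∧ e.2 ∈ V ∧ e.1.1 < e.2.1)
    (hv : ∀ e ∈ E, ∀ v ∈ V, e.1.1 < v.1 → v.1 < e.2.1 → v.2 ≠ ev e v.1)
    (hc : ∀ e ∈ E, ∀ f ∈ E, NoCross e f)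
    {lo hi lo' hi' q} (w : Wedge V E lo hi q) (w' : Wedge V E lo' hi' q)
    (t1 : q.2 = ev hi q.1 ↔ q.2 = ev hi' q.1) (t2 : q.2 = ev lo q.1 ↔ q.2 = ev lo' q.1)
    (hle : lo.1.1 ≤ lo'.1.1) : lo = lo' := by
  have a1 := w.q_above
  have a2 := w.q_below
  have a3 := w'.q_above
  have a4 := w'.q_below
  have a5 := w.lt
  have a6 := w'.lt
  have c1 : ev hi q.1 ≤ ev lo' q.1 → False := by
    intro h
    have h1 : q.2 = ev hi q.1 := by linarith
    have h2 : q.2 = ev hi' q.1 := t1.1 h1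
    linarith
  have c2 : ev hi' q.1 ≤ ev lo q.1 → False := by
    intro h
    have h1 : q.2 = ev hi' q.1 := by linarith
    have h2 : q.2 = ev hi q.1 := t1.2 h1
    linarith
  have hp : lo.1 = lo'.1 := by
    by_contra hne
    have hside : ev hi lo'.1.1 < lo'.1.2 ∨ lo'.1.2 < ev lo lo'.1.1 := by
      rcases hle.lt_or_eq with h | h
      · by_contra hcon
        push Not at hcon
        exact w.first lo'.1 (hE _ w'.lo_mem).1 h w'.q_left hcon.2 hcon.1
      · have h2 : lo.1.2 ≠ lo'.1.2 := fun h2 => hne (Prod.ext h h2)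
        rw [← h, ev_left, w.same, ev_left, ← w.same]
        exact lt_or_gt_of_ne h2
    rcases hside with h | h
    · apply c1
      refine hc hi w.hi_mem lo' w'.lo_mem lo'.1.1 q.1 ?_ le_rfl w'.q_left w.q_hi w'.q_lo ?_
      · rw [← w.same]; exact hle
      · rw [ev_left]; exact h
    · apply c2
      refine hc hi' w'.hi_mem lo w.lo_mem lo'.1.1 q.1 ?_ hle w'.q_left w'.q_hi w.q_lo ?_
      · rw [← w'.same]
      · rw [w'.same, ev_left, ← w'.same]; exact h
  have mono : ∀ e f : (ℝ × ℝ) × (ℝ × ℝ), e.1 = lo.1 → f.1 = lo.1 → sl e ≤ sl f →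
      ev e q.1 ≤ ev f q.1 := by
    intro e f he hf h
    have := w.q_left
    unfold ev
    rw [he, hf]
    nlinarith
  rcases lt_trichotomy (sl lo) (sl lo') with h | h | h
  · exact (c1 (mono _ _ w.same.symm hp.symm (w.next lo' w'.lo_mem hp.symm h))).elim
  · exact eq_of_sl hE hv w.lo_mem w'.lo_mem hp h
  · exact (c2 (mono _ _ (w'.same.symm.trans hp.symm) rfl (w'.next lo w.lo_mem hp h))).elim

lemma wedge_unique {V : Finset (ℝ × ℝ)} {E : Finset ((ℝ × ℝ) × (ℝ × ℝ))}
    (hE : ∀ e ∈ E, e.1 ∈ V ∧ e.2 ∈ V ∧ e.1.1 < e.2.1)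
    (hv : ∀ e ∈ E, ∀ v ∈ V, e.1.1 < v.1 → v.1 < e.2.1 → v.2 ≠ ev e v.1)
    (hc : ∀ e ∈ E, ∀ f ∈ E, NoCross e f)
    {lo hi lo' hi' q} (w : Wedge V E lo hi q) (w' : Wedge V E lo' hi' q)
    (t1 : q.2 = ev hi q.1 ↔ q.2 = ev hi' q.1) (t2 : q.2 = ev lo q.1 ↔ q.2 = ev lo' q.1) :
    lo = lo' := by
  rcases le_total lo.1.1 lo'.1.1 with h | h
  · exact wedge_unique_aux hE hv hc w w' t1 t2 h
  · exact (wedge_unique_aux hE hv hc w' w t1.symm t2.symm h).symm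

lemma wedge_exists {V : Finset (ℝ × ℝ)} {E : Finset ((ℝ × ℝ) × (ℝ × ℝ))}
    (hE : ∀ e ∈ E, e.1 ∈ V ∧ e.2 ∈ V ∧ e.1.1 < e.2.1)
    {lo} (hlo : lo ∈ E) (ht : ¬ ∀ f ∈ E, f.1 = lo.1 → sl f ≤ sl lo) :
    ∃ hi q, Wedge V E lo hi q := by
  classical
  push Not at ht
  obtain ⟨f0, hf0, hf1, hf2⟩ := ht
  obtain ⟨hi, hhi, hmin⟩ := (E.filter (fun f => f.1 = lo.1 ∧ sl lo < sl f)).exists_min_image sl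
    ⟨f0, by simp [hf0, hf1, hf2]⟩
  simp only [Finset.mem_filter] at hhi hmin
  obtain ⟨hhiE, hsame, hslt⟩ := hhi
  obtain ⟨-, l2, l3⟩ := hE lo hlo
  obtain ⟨-, r2, r3⟩ := hE hi hhiE
  have mono : ∀ x, lo.1.1 ≤ x → ev lo x ≤ ev hi x := by
    intro x hx
    unfold ev
    rw [hsame]
    nlinarith
  have hne : (V.filter (fun v => lo.1.1 < v.1 ∧ v.1 ≤ lo.2.1 ∧ v.1 ≤ hi.2.1 ∧
      ev lo v.1 ≤ v.2 ∧ v.2 ≤ ev hi v.1)).Nonempty := by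
    rcases le_total lo.2.1 hi.2.1 with h | h
    · refine ⟨lo.2, ?_⟩
      simp only [Finset.mem_filter]
      have := mono lo.2.1 l3.le
      rw [ev_right lo l3] at this
      exact ⟨l2, l3, le_rfl, h, (ev_right lo l3).le, this⟩
    · refine ⟨hi.2, ?_⟩
      simp only [Finset.mem_filter]
      rw [hsame] at r3
      have := mono hi.2.1 r3.le
      rw [ev_right hi (by rw [hsame]; exact r3)] at this
      exact ⟨r2, r3, h, le_rfl, this, (ev_right hi (by rw [hsame]; exact r3)).ge⟩
  obtain ⟨q, hq, hqmin⟩ := Finset.exists_min_image _ (fun v : ℝ × ℝ => v.1) hne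
  simp only [Finset.mem_filter] at hq hqmin
  obtain ⟨q0, q1, q2, q3, q4, q5⟩ := hq
  refine ⟨hi, q, hlo, hhiE, hsame.symm, hslt, fun f hf h1 h2 => hmin f ⟨hf, h1, h2⟩, q0, q1, q2, q3,
    q4, q5, ?_⟩
  intro v hv h1 h2 h3 h4
  have := hqmin v ⟨hv, h1, by linarith, by linarith, h3, h4⟩
  linarith

theorem plane (V : Finset (ℝ × ℝ)) (E : Finset ((ℝ × ℝ) × (ℝ × ℝ)))
    (hE : ∀ e ∈ E, e.1 ∈ V ∧ e.2 ∈ V ∧ e.1.1 < e.2.1)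
    (hv : ∀ e ∈ E, ∀ v ∈ V, e.1.1 < v.1 → v.1 < e.2.1 → v.2 ≠ ev e v.1)
    (hc : ∀ e ∈ E, ∀ f ∈ E, NoCross e f) : E.card ≤ 5 * V.card := by
  classical
  have hsplit := Finset.card_filter_add_card_filter_not (s := E)
    (fun e => ∀ f ∈ E, f.1 = e.1 → sl f ≤ sl e)
  have h1 : (E.filter (fun e => ∀ f ∈ E, f.1 = e.1 → sl f ≤ sl e)).card ≤ V.card := by
    apply Finset.card_le_card_of_injOn (fun e => e.1)
    · intro e he
      simp only [Finset.coe_filter, Set.mem_ofPred_eq] at he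
      exact (hE e he.1).1
    · intro e he f hf h
      simp only [Finset.coe_filter, Set.mem_ofPred_eq] at he hf h
      exact eq_of_sl hE hv he.1 hf.1 h (le_antisymm (hf.2 e he.1 h) (he.2 f hf.1 h.symm))
  have h2 : (E.filter (fun e => ¬ ∀ f ∈ E, f.1 = e.1 → sl f ≤ sl e)).card ≤
      (V ×ˢ (Finset.univ : Finset (Bool × Bool))).card := by
    have hex : ∀ e, ∃ hi q, e ∈ E.filter (fun e => ¬ ∀ f ∈ E, f.1 = e.1 → sl f ≤ sl e) →
        Wedge V E e hi q := by
      intro e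
      by_cases he : e ∈ E.filter (fun e => ¬ ∀ f ∈ E, f.1 = e.1 → sl f ≤ sl e)
      · have he2 := Finset.mem_filter.1 he
        obtain ⟨hi, q, h⟩ := wedge_exists hE he2.1 he2.2
        exact ⟨hi, q, fun _ => h⟩
      · exact ⟨e, 0, fun h => absurd h he⟩
    choose hi q hw using hex
    apply Finset.card_le_card_of_injOn
      (fun e => (q e, (decide ((q e).2 = ev (hi e) (q e).1), decide ((q e).2 = ev e (q e).1))))
    · intro e he
      simp only [Finset.coe_product, Set.mem_prod]
      exact ⟨(hw e he).q_mem, by simp⟩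
    · intro e he f hf h
      have w1 := hw e he
      have w2 := hw f hf
      simp only [Prod.mk.injEq, decide_eq_decide] at h
      obtain ⟨hq, t1, t2⟩ := h
      rw [← hq] at w2 t1 t2
      exact wedge_unique hE hv hc w1 w2 t1 t2
  rw [Finset.card_product] at h2
  simp at h2 hsplit h1
  omega

/-- Expectation of a random subset containing `T`. -/
lemma sum_weights (P T : Finset (ℝ × ℝ)) (hT : T ⊆ P) (p : ℝ) :
    ∑ S ∈ P.powerset, (if T ⊆ S then p ^ S.card * (1 - p) ^ (P.card - S.card) else 0)
      = p ^ T.card := by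
  classical
  rw [← Finset.sum_filter]
  have : P.powerset.filter (fun S => T ⊆ S) = Finset.Icc T P := by
    ext S; simp [and_comm]
  rw [this, Finset.Icc_eq_image_powerset hT, Finset.sum_image]
  · have h := Finset.sum_pow_mul_eq_add_pow p (1 - p) (P \ T)
    rw [add_sub_cancel, one_pow] at h
    refine Eq.trans ?_ ((congrArg (fun r => p ^ T.card * r) h).trans (mul_one _))
    simp only [Finset.mul_sum]
    apply Finset.sum_congr rfl
    intro S hS
    rw [Finset.mem_powerset] at hS
    have hd : Disjoint T S := by
      rw [Finset.disjoint_left]; intro a ha hb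
      exact (Finset.mem_sdiff.1 (hS hb)).2 ha
    rw [Finset.card_union_of_disjoint hd, Finset.card_sdiff_of_subset hT, pow_add,
      Nat.sub_add_eq, mul_assoc]
  · intro A hA B hB h
    simp only [Finset.coe_powerset, Set.mem_preimage, Set.mem_powerset_iff, Finset.coe_subset] at hA hB
    have key : ∀ A : Finset (ℝ × ℝ), A ⊆ P \ T → A = (T ∪ A) \ T := by
      intro A hA
      ext a
      have := @hA a
      simp only [Finset.mem_sdiff, Finset.mem_union] at *
      tauto
    rw [key A hA, key B hB]
    simp only at h
    rw [h]

/-- The edges of the incidence graph. -/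
def IsEdge (P M : Finset (ℝ × ℝ)) (e : (ℝ × ℝ) × (ℝ × ℝ)) : Prop :=
  e.1 ∈ P ∧ e.2 ∈ P ∧ e.1.1 < e.2.1 ∧ ln e ∈ M ∧
    ∀ v ∈ P, e.1.1 < v.1 → v.1 < e.2.1 → v.2 ≠ ev e v.1

def Crosses (e f : (ℝ × ℝ) × (ℝ × ℝ)) : Prop :=
  ln e ≠ ln f ∧ ∃ x, e.1.1 < x ∧ x < e.2.1 ∧ f.1.1 < x ∧ x < f.2.1 ∧ ev e x = ev f x

lemma ln_eq_of_two {e f : (ℝ × ℝ) × (ℝ × ℝ)} {x y : ℝ} (hxy : x ≠ y) (hx : ev e x = ev f x)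
    (hy : ev e y = ev f y) : ln e = ln f := by
  simp only [ev_ln] at hx hy
  have h : ((ln e).1 - (ln f).1) * (x - y) = 0 := by linarith
  have h1 : (ln e).1 = (ln f).1 := by
    rcases mul_eq_zero.1 h with h | h
    · linarith
    · exact absurd (by linarith) hxy
  refine Prod.ext h1 ?_
  rw [h1] at hx
  linarith

lemma edge_eq {P M : Finset (ℝ × ℝ)} {e f : (ℝ × ℝ) × (ℝ × ℝ)} (he : IsEdge P M e)
    (hf : IsEdge P M f) (hl : ln e = ln f) {x : ℝ} (h1 : e.1.1 < x) (h2 : x < e.2.1)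
    (h3 : f.1.1 < x) (h4 : x < f.2.1) : e = f := by
  have hev : ∀ x, ev e x = ev f x := fun x => by rw [ev_ln, ev_ln, hl]
  obtain ⟨e1, e2, e3, -, e4⟩ := he
  obtain ⟨f1, f2, f3, -, f4⟩ := hf
  have a1 := ev_left e
  have a2 := ev_right e e3
  have b1 := ev_left f
  have b2 := ev_right f f3
  have hl1 : e.1.1 = f.1.1 := by
    rcases lt_trichotomy e.1.1 f.1.1 with h | h | h
    · exact absurd (by rw [hev, b1]) (e4 f.1 f1 h (by linarith))
    · exact h
    · exact absurd (by rw [← hev, a1]) (f4 e.1 e1 h (by linarith))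
  have hr1 : e.2.1 = f.2.1 := by
    rcases lt_trichotomy e.2.1 f.2.1 with h | h | h
    · exact absurd (by rw [← hev, a2]) (f4 e.2 e2 (by linarith) h)
    · exact h
    · exact absurd (by rw [hev, b2]) (e4 f.2 f2 (by linarith) h)
  refine Prod.ext (Prod.ext hl1 ?_) (Prod.ext hr1 ?_)
  · rw [← a1, ← b1, hev, hl1]
  · rw [← a2, ← b2, hev, hr1]

lemma noCross_of {e f : (ℝ × ℝ) × (ℝ × ℝ)} (h : ¬ Crosses e f) : NoCross e f := by
  intro x y h1 h2 h3 h4 h5 h6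
  by_contra h7
  push Not at h7
  apply h
  constructor
  · intro hl
    rw [ev_ln, ev_ln, hl] at h6
    exact lt_irrefl _ h6
  · have hcont : ContinuousOn (fun t => ev f t - ev e t) (Set.Icc x y) := by
      unfold ev; fun_prop
    have := intermediate_value_Ioo' h3.le hcont (show (0 : ℝ) ∈ _ from ⟨by simpa using h7, by simpa using h6⟩)
    obtain ⟨t, ⟨ht1, ht2⟩, ht⟩ := this
    simp only at ht
    exact ⟨t, by linarith, by linarith, by linarith, by linarith, by linarith⟩

lemma cross_card {e f : (ℝ × ℝ) × (ℝ × ℝ)} (he : e.1.1 < e.2.1) (hf : f.1.1 < f.2.1)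
    (h : Crosses e f) : ({e.1, e.2, f.1, f.2} : Finset (ℝ × ℝ)).card = 4 := by
  obtain ⟨hl, x, h1, h2, h3, h4, h5⟩ := h
  have n1 : e.1 ≠ e.2 := fun h => by rw [h] at he; exact lt_irrefl _ he
  have n2 : f.1 ≠ f.2 := fun h => by rw [h] at hf; exact lt_irrefl _ hf
  have n3 : e.1 ≠ f.2 := fun h => by rw [h] at h1; linarith
  have n4 : e.2 ≠ f.1 := fun h => by rw [h] at h2; linarith
  have n5 : e.1 ≠ f.1 := fun h => hl (ln_eq_of_two h1.ne (by
    rw [ev_left, h, ev_left]) h5)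
  have n6 : e.2 ≠ f.2 := fun h => hl (ln_eq_of_two h2.ne h5 (by
    rw [ev_right e he, h, ev_right f hf]))
  rw [Finset.card_insert_of_notMem, Finset.card_insert_of_notMem, Finset.card_pair n2]
  · simp [n4, n6]
  · simp [n1, n3, n5]

open Classical in
theorem sampled (P M : Finset (ℝ × ℝ)) (E : Finset ((ℝ × ℝ) × (ℝ × ℝ)))
    (hE : ∀ e ∈ E, IsEdge P M e) (S : Finset (ℝ × ℝ)) (hS : S ⊆ P) :
    (E.filter (fun e => {e.1, e.2} ⊆ S)).card ≤ 5 * S.card +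
      (((E ×ˢ E).filter (fun z => Crosses z.1 z.2)).filter
        (fun z => {z.1.1, z.1.2, z.2.1, z.2.2} ⊆ S)).card := by
  set X := ((E ×ˢ E).filter (fun z => Crosses z.1 z.2)).filter
        (fun z => {z.1.1, z.1.2, z.2.1, z.2.2} ⊆ S) with hX
  set F := E.filter (fun e => {e.1, e.2} ⊆ S) with hF
  have hFm : ∀ e ∈ F, e ∈ E ∧ e.1 ∈ S ∧ e.2 ∈ S := by
    intro e he
    simpa [hF, Finset.insert_subset_iff] using he
  have h1 : (F \ X.image Prod.fst).card ≤ 5 * S.card := by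
    apply plane
    · intro e he
      have := hFm e (Finset.mem_sdiff.1 he).1
      exact ⟨this.2.1, this.2.2, (hE e this.1).2.2.1⟩
    · intro e he v hv
      have := hFm e (Finset.mem_sdiff.1 he).1
      exact (hE e this.1).2.2.2.2 v (hS hv)
    · intro e he f hf
      apply noCross_of
      intro hc
      apply (Finset.mem_sdiff.1 he).2
      have h1 := hFm e (Finset.mem_sdiff.1 he).1
      have h2 := hFm f (Finset.mem_sdiff.1 hf).1
      rw [Finset.mem_image]
      refine ⟨(e, f), ?_, rfl⟩
      simp [hX, Finset.insert_subset_iff, h1, h2, hc]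
  have h2 : F.card ≤ (F \ X.image Prod.fst).card + (X.image Prod.fst).card := by
    have := Finset.le_card_sdiff (X.image Prod.fst) F
    omega
  have h3 : (X.image Prod.fst).card ≤ X.card := Finset.card_image_le
  omega

open Classical in
theorem crossings_le (P M : Finset (ℝ × ℝ)) (E : Finset ((ℝ × ℝ) × (ℝ × ℝ)))
    (hE : ∀ e ∈ E, IsEdge P M e) :
    ((E ×ˢ E).filter (fun z => Crosses z.1 z.2)).card ≤ M.card ^ 2 := by
  rw [sq, ← Finset.card_product]
  apply Finset.card_le_card_of_injOn (fun z => (ln z.1, ln z.2))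
  · intro z hz
    simp only [Finset.coe_filter, Set.mem_ofPred_eq, Finset.mem_product] at hz
    simp only [Finset.coe_product, Set.mem_prod]
    exact ⟨(hE _ hz.1.1).2.2.2.1, (hE _ hz.1.2).2.2.2.1⟩
  · rintro ⟨e, f⟩ hz ⟨e', f'⟩ hz' h
    simp only [Finset.coe_filter, Set.mem_ofPred_eq, Finset.mem_product, Prod.mk.injEq] at hz hz' h
    obtain ⟨⟨he, hf⟩, hl, x, h1, h2, h3, h4, h5⟩ := hz
    obtain ⟨⟨he', hf'⟩, hl', x', h1', h2', h3', h4', h5'⟩ := hz'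
    have hx : x = x' := by
      by_contra hne
      apply hl
      apply ln_eq_of_two hne h5
      rw [ev_ln, ev_ln, h.1, h.2, ← ev_ln, ← ev_ln, h5']
    subst hx
    rw [edge_eq (hE _ he) (hE _ he') h.1 h1 h2 h1' h2', edge_eq (hE _ hf) (hE _ hf') h.2 h3 h4 h3' h4']

theorem averaged (P M : Finset (ℝ × ℝ)) (E : Finset ((ℝ × ℝ) × (ℝ × ℝ)))
    (hE : ∀ e ∈ E, IsEdge P M e) (p : ℝ) (hp0 : 0 ≤ p) (hp1 : p ≤ 1) :
    (E.card : ℝ) * p ^ 2 ≤ 5 * (P.card * p) + (M.card : ℝ) ^ 2 * p ^ 4 := by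
  classical
  set X := (E ×ˢ E).filter (fun z => Crosses z.1 z.2) with hX
  set w : Finset (ℝ × ℝ) → ℝ := fun S => p ^ S.card * (1 - p) ^ (P.card - S.card) with hw
  have hw0 : ∀ S, 0 ≤ w S := fun S => mul_nonneg (pow_nonneg hp0 _) (pow_nonneg (by linarith) _)
  have gen : ∀ {α : Type} (A : Finset α) (T : α → Finset (ℝ × ℝ)) (k : ℕ),
      (∀ a ∈ A, T a ⊆ P ∧ (T a).card = k) →
      ∑ S ∈ P.powerset, w S * ((A.filter (fun a => T a ⊆ S)).card : ℝ) = A.card * p ^ k := by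
    intro α A T k hA
    have : ∀ S ∈ P.powerset, w S * ((A.filter (fun a => T a ⊆ S)).card : ℝ) =
        ∑ a ∈ A, if T a ⊆ S then w S else 0 := by
      intro S _
      rw [← Finset.sum_filter, Finset.sum_const, nsmul_eq_mul, mul_comm]
    rw [Finset.sum_congr rfl this, Finset.sum_comm]
    rw [Finset.sum_congr rfl (fun a ha => (sum_weights P (T a) (hA a ha).1 p).trans
      (by rw [(hA a ha).2])), Finset.sum_const, nsmul_eq_mul]
  have s1 := gen E (fun e => {e.1, e.2}) 2 (by
    intro e he
    obtain ⟨h1, h2, h3, -⟩ := hE e he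
    refine ⟨by simp [Finset.insert_subset_iff, h1, h2], Finset.card_pair ?_⟩
    intro h; rw [h] at h3; exact lt_irrefl _ h3)
  have s2 := gen P (fun v => {v}) 1 (by intro v hv; simp [hv])
  have s3 := gen X (fun z => {z.1.1, z.1.2, z.2.1, z.2.2}) 4 (by
    intro z hz
    simp only [hX, Finset.mem_filter, Finset.mem_product] at hz
    obtain ⟨h1, h2, h3, -⟩ := hE z.1 hz.1.1
    obtain ⟨k1, k2, k3, -⟩ := hE z.2 hz.1.2
    exact ⟨by simp [Finset.insert_subset_iff, h1, h2, k1, k2], cross_card h3 k3 hz.2⟩)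
  have hXc : (X.card : ℝ) ≤ (M.card : ℝ) ^ 2 := by exact_mod_cast crossings_le P M E hE
  have main : ∑ S ∈ P.powerset, w S * ((E.filter (fun e => {e.1, e.2} ⊆ S)).card : ℝ) ≤
      5 * ∑ S ∈ P.powerset, w S * ((P.filter (fun v => {v} ⊆ S)).card : ℝ) +
      ∑ S ∈ P.powerset, w S * ((X.filter (fun z => {z.1.1, z.1.2, z.2.1, z.2.2} ⊆ S)).card : ℝ) := by
    rw [Finset.mul_sum, ← Finset.sum_add_distrib]
    apply Finset.sum_le_sum
    intro S hS
    rw [Finset.mem_powerset] at hS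
    have h1 := sampled P M E hE S hS
    have h2 : P.filter (fun v => {v} ⊆ S) = S := by
      ext v; simp only [Finset.mem_filter, Finset.singleton_subset_iff]
      exact ⟨fun h => h.2, fun h => ⟨hS h, h⟩⟩
    rw [h2]
    have h3 : ((E.filter (fun e => {e.1, e.2} ⊆ S)).card : ℝ) ≤ 5 * S.card +
      ((X.filter (fun z => {z.1.1, z.1.2, z.2.1, z.2.2} ⊆ S)).card : ℝ) := by
      exact_mod_cast h1
    have := mul_le_mul_of_nonneg_left h3 (hw0 S)
    linarith
  rw [s1, s2, s3, pow_one] at main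
  have := mul_le_mul_of_nonneg_right hXc (pow_nonneg hp0 4)
  linarith

theorem edges_le (P M : Finset (ℝ × ℝ)) (E : Finset ((ℝ × ℝ) × (ℝ × ℝ)))
    (hE : ∀ e ∈ E, IsEdge P M e) :
    (E.card : ℝ) ≤ 6 * ((M.card : ℝ) ^ ((2 : ℝ) / 3) * (P.card : ℝ) ^ ((2 : ℝ) / 3)) +
      6 * P.card := by
  have hn0 : (0 : ℝ) ≤ P.card := Nat.cast_nonneg _
  have hm0 : (0 : ℝ) ≤ M.card := Nat.cast_nonneg _
  have av := averaged P M E hE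
  set n : ℝ := (P.card : ℝ) with hn
  set m : ℝ := (M.card : ℝ) with hm
  have hz : 0 ≤ m ^ ((2 : ℝ) / 3) * n ^ ((2 : ℝ) / 3) := by positivity
  rcases lt_or_ge (m ^ 2) n with h | h
  · have := av 1 zero_le_one le_rfl
    linarith
  · rcases hn0.eq_or_lt with h0 | h0
    · have : P = ∅ := by
        rw [← Finset.card_eq_zero, ← Nat.cast_eq_zero (R := ℝ), ← hn]; exact h0.symm
      have hE0 : E = ∅ := by
        rw [Finset.eq_empty_iff_forall_notMem]
        intro e he
        have he1 := (hE e he).1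
        rw [this] at he1
        exact Finset.notMem_empty _ he1
      rw [hE0]
      simp only [Finset.card_empty, Nat.cast_zero]
      linarith
    · have hmp : 0 < m := by
        rcases hm0.eq_or_lt with h1 | h1
        · rw [← h1] at h; norm_num at h; linarith
        · exact h1
      -- a = m^(1/3), b = n^(1/3)
      obtain ⟨a, ha, ham⟩ : ∃ a : ℝ, 0 < a ∧ a ^ 3 = m :=
        ⟨m ^ ((1 : ℝ) / 3), by positivity, by
          rw [← Real.rpow_natCast, ← Real.rpow_mul hm0]; norm_num⟩
      obtain ⟨b, hb, hbn⟩ : ∃ b : ℝ, 0 < b ∧ b ^ 3 = n :=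
        ⟨n ^ ((1 : ℝ) / 3), by positivity, by
          rw [← Real.rpow_natCast, ← Real.rpow_mul hn0]; norm_num⟩
      have e1 : m ^ ((2 : ℝ) / 3) = a ^ 2 := by
        rw [← ham, ← Real.rpow_natCast, ← Real.rpow_mul ha.le, ← Real.rpow_natCast]; norm_num
      have e2 : n ^ ((2 : ℝ) / 3) = b ^ 2 := by
        rw [← hbn, ← Real.rpow_natCast, ← Real.rpow_mul hb.le, ← Real.rpow_natCast]; norm_num
      rw [e1, e2]
      have hba : b ≤ a ^ 2 := by
        apply le_of_pow_le_pow_left₀ (n := 3) (by norm_num) (by positivity)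
        rw [hbn]; rw [← ham] at h; linarith [h, (by ring : (a ^ 3) ^ 2 = (a ^ 2) ^ 3)]
      have := av (b / a ^ 2) (by positivity) (by rw [div_le_one (by positivity)]; exact hba)
      rw [← ham, ← hbn] at this
      have h2 : (E.card : ℝ) ≤ 6 * (a ^ 2 * b ^ 2) := by
        have h3 : 5 * (b ^ 3 * (b / a ^ 2)) + (a ^ 3) ^ 2 * (b / a ^ 2) ^ 4 =
            6 * (a ^ 2 * b ^ 2) * (b / a ^ 2) ^ 2 := by
          field_simp
          ring
        rw [h3] at this
        exact le_of_mul_le_mul_right this (by positivity)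
      linarith

lemma line_cases {ℓ : Set (ℝ × ℝ)} (h : IsLine ℓ) :
    (∃ c : ℝ, ℓ = {p | p.1 = c}) ∨ ∃ m : ℝ × ℝ, ℓ = {p | p.2 = m.1 * p.1 + m.2} := by
  obtain ⟨a, b, c, hab, rfl⟩ := h
  by_cases hb : b = 0
  · left
    have ha : a ≠ 0 := fun ha => hab (by rw [ha, hb])
    refine ⟨c / a, ?_⟩
    ext p
    simp only [Set.mem_ofPred_eq, hb]
    rw [eq_div_iff ha]
    constructor <;> intro h <;> linarith
  · right
    refine ⟨(-a / b, c / b), ?_⟩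
    ext p
    simp only [Set.mem_ofPred_eq]
    constructor
    · intro h; field_simp; linarith
    · intro h; rw [h]; field_simp; ring

lemma ln_of_mem {p q : ℝ × ℝ} {m : ℝ × ℝ} (hpq : p.1 < q.1) (hp : p.2 = m.1 * p.1 + m.2)
    (hq : q.2 = m.1 * q.1 + m.2) : ln (p, q) = m := by
  have h : q.1 - p.1 ≠ 0 := by linarith
  have h1 : sl (p, q) = m.1 := by
    simp only [sl]
    rw [div_eq_iff h, hp, hq]; ring
  refine Prod.ext h1 ?_
  simp only [ln, h1]
  rw [hp]; ring

end SzT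

open SzT in
/-- Szemerédi–Trotter, incidence form. -/
theorem szemeredi_trotter_incidences :
    ∃ C : ℝ, 0 < C ∧
      ∀ (P : Finset (ℝ × ℝ)) (L : Finset (Set (ℝ × ℝ))),
        (∀ ℓ ∈ L, IsLine ℓ) →
        ({pl : (ℝ × ℝ) × Set (ℝ × ℝ) | pl.1 ∈ P ∧ pl.2 ∈ L ∧ pl.1 ∈ pl.2}.ncard : ℝ) ≤
          C * ((L.card : ℝ) ^ ((2 : ℝ) / 3) * (P.card : ℝ) ^ ((2 : ℝ) / 3) +
            (L.card : ℝ) + (P.card : ℝ)) := by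
  refine ⟨7, by norm_num, ?_⟩
  intro P L hL
  classical
  set I : Finset ((ℝ × ℝ) × Set (ℝ × ℝ)) := (P ×ˢ L).filter (fun z => z.1 ∈ z.2) with hI
  have hset : {pl : (ℝ × ℝ) × Set (ℝ × ℝ) | pl.1 ∈ P ∧ pl.2 ∈ L ∧ pl.1 ∈ pl.2} = ↑I := by
    ext z; simp [hI, and_assoc]
  rw [hset, Set.ncard_coe_finset]
  have hIm : ∀ z ∈ I, z.1 ∈ P ∧ z.2 ∈ L ∧ z.1 ∈ z.2 := by
    intro z hz; simpa [hI, and_assoc] using hz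
  -- split off vertical lines
  have hs1 := Finset.card_filter_add_card_filter_not (s := I) (fun z => ∃ c : ℝ, z.2 = {p | p.1 = c})
  set I1 := I.filter (fun z => ∃ c : ℝ, z.2 = {p | p.1 = c}) with hI1
  set I2 := I.filter (fun z => ¬ ∃ c : ℝ, z.2 = {p | p.1 = c}) with hI2
  have hs2 := Finset.card_filter_add_card_filter_not (s := I2) (fun z => ∀ q ∈ P, q ∈ z.2 → q.1 ≤ z.1.1)
  set I3 := I2.filter (fun z => ∀ q ∈ P, q ∈ z.2 → q.1 ≤ z.1.1) with hI3
  set I4 := I2.filter (fun z => ¬ ∀ q ∈ P, q ∈ z.2 → q.1 ≤ z.1.1) with hI4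
  have hI2m : ∀ z ∈ I2, z ∈ I ∧ ∃ m : ℝ × ℝ, z.2 = {p | p.2 = m.1 * p.1 + m.2} := by
    intro z hz
    rw [hI2, Finset.mem_filter] at hz
    exact ⟨hz.1, (line_cases (hL z.2 (hIm z hz.1).2.1)).resolve_left hz.2⟩
  have c1 : I1.card ≤ P.card := by
    apply Finset.card_le_card_of_injOn (fun z => z.1)
    · intro z hz
      exact (hIm z (Finset.mem_filter.1 hz).1).1
    · intro z hz y hy h
      obtain ⟨hz1, c, hc⟩ := Finset.mem_filter.1 hz
      obtain ⟨hy1, d, hd⟩ := Finset.mem_filter.1 hy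
      have k1 := (hIm z hz1).2.2
      have k2 := (hIm y hy1).2.2
      simp only at h
      rw [hc] at k1
      rw [hd, ← h] at k2
      simp only [Set.mem_ofPred_eq] at k1 k2
      exact Prod.ext h (by rw [hc, hd, ← k1, ← k2])
  have c3 : I3.card ≤ L.card := by
    apply Finset.card_le_card_of_injOn (fun z => z.2)
    · intro z hz
      exact (hIm z (hI2m z (Finset.mem_filter.1 hz).1).1).2.1
    · intro z hz y hy h
      obtain ⟨hz1, hz2⟩ := Finset.mem_filter.1 hz
      obtain ⟨hy1, hy2⟩ := Finset.mem_filter.1 hy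
      obtain ⟨hz3, m, hm⟩ := hI2m z hz1
      obtain ⟨zP, zL, zm⟩ := hIm z hz3
      obtain ⟨yP, yL, ym⟩ := hIm y (hI2m y hy1).1
      simp only at h
      have hx : z.1.1 = y.1.1 :=
        le_antisymm (hy2 z.1 zP (by rw [← h]; exact zm)) (hz2 y.1 yP (by rw [h]; exact ym))
      rw [← h, hm] at ym
      rw [hm] at zm
      simp only [Set.mem_ofPred_eq] at ym zm
      exact Prod.ext (Prod.ext hx (by rw [ym, zm, hx])) h
  -- slopes and intercepts
  have hphi : ∀ ℓ : Set (ℝ × ℝ), ∃ m : ℝ × ℝ,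
      (∃ m : ℝ × ℝ, ℓ = {p | p.2 = m.1 * p.1 + m.2}) → ℓ = {p | p.2 = m.1 * p.1 + m.2} := by
    intro ℓ
    by_cases h : ∃ m : ℝ × ℝ, ℓ = {p | p.2 = m.1 * p.1 + m.2}
    · obtain ⟨m, hm⟩ := h
      exact ⟨m, fun _ => hm⟩
    · exact ⟨0, fun h' => absurd h' h⟩
  choose φ hφ using hphi
  set M := L.image φ with hM
  have hMc : (M.card : ℝ) ≤ L.card := by exact_mod_cast Finset.card_image_le
  set E := (P ×ˢ P).filter (IsEdge P M) with hE
  have c4 : I4.card ≤ E.card := by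
    have hex : ∀ z, ∃ e, z ∈ I4 → e ∈ E ∧ e.1 = z.1 ∧ ln e = φ z.2 := by
      intro z
      by_cases hz : z ∈ I4
      · obtain ⟨hz1, hz2⟩ := Finset.mem_filter.1 hz
        obtain ⟨hz3, hm⟩ := hI2m z hz1
        have hm := hφ _ hm
        obtain ⟨zP, zL, zm⟩ := hIm z hz3
        push Not at hz2
        obtain ⟨q0, q0P, q0m, q0x⟩ := hz2
        obtain ⟨q, hq, hqmin⟩ := (P.filter (fun q => q ∈ z.2 ∧ z.1.1 < q.1)).exists_min_image
          (fun q => q.1) ⟨q0, by simp [q0P, q0m, q0x]⟩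
        simp only [Finset.mem_filter] at hq hqmin
        obtain ⟨qP, qm, qx⟩ := hq
        have mem : ∀ v : ℝ × ℝ, v ∈ z.2 ↔ v.2 = (φ z.2).1 * v.1 + (φ z.2).2 := by
          intro v
          conv_lhs => rw [hm]
          rfl
        have hln : ln (z.1, q) = φ z.2 := ln_of_mem qx ((mem _).1 zm) ((mem _).1 qm)
        refine ⟨(z.1, q), fun _ => ⟨?_, rfl, hln⟩⟩
        rw [hE, Finset.mem_filter]
        refine ⟨Finset.mem_product.2 ⟨zP, qP⟩, zP, qP, qx, ?_, ?_⟩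
        · rw [hln]; exact Finset.mem_image_of_mem _ zL
        · intro v vP v1 v2 hv
          rw [ev_ln, hln, ← mem] at hv
          have := hqmin v ⟨vP, hv, v1⟩
          simp only at v2
          linarith
      · exact ⟨0, fun h => absurd h hz⟩
    choose g hg using hex
    apply Finset.card_le_card_of_injOn g
    · intro z hz
      exact (hg z hz).1
    · intro z hz y hy h
      obtain ⟨-, a1, a2⟩ := hg z hz
      obtain ⟨-, b1, b2⟩ := hg y hy
      have hm := hφ _ (hI2m z (Finset.mem_filter.1 hz).1).2
      have hm' := hφ _ (hI2m y (Finset.mem_filter.1 hy).1).2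
      refine Prod.ext (by rw [← a1, ← b1, h]) ?_
      rw [hm, hm', ← a2, ← b2, h]
  have hEc := edges_le P M E (fun e he => (Finset.mem_filter.1 he).2)
  have hmono : (M.card : ℝ) ^ ((2 : ℝ) / 3) * (P.card : ℝ) ^ ((2 : ℝ) / 3) ≤
      (L.card : ℝ) ^ ((2 : ℝ) / 3) * (P.card : ℝ) ^ ((2 : ℝ) / 3) := by
    exact mul_le_mul_of_nonneg_right
      (Real.rpow_le_rpow (Nat.cast_nonneg _) hMc (by norm_num)) (Real.rpow_nonneg (Nat.cast_nonneg _) _)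
  have htot : (I.card : ℝ) ≤ P.card + L.card + E.card := by
    have : I.card ≤ P.card + L.card + E.card := by omega
    exact_mod_cast this
  have hz : 0 ≤ (L.card : ℝ) ^ ((2 : ℝ) / 3) * (P.card : ℝ) ^ ((2 : ℝ) / 3) := by positivity
  have hl : (0 : ℝ) ≤ L.card := Nat.cast_nonneg _
  linarith
end

section
/- (Beck's theorem) There exist absolute constants c ≥ 1 and C > 0 such that for every finite set P of n points in ℝ², either some line contains at least n/c points of P, or else the number of distinct lines containing at least two points of P is at least n²/C. -/
namespace Beck

/-- slope -/
noncomputable def sl (p q : ℝ × ℝ) : ℝ := (q.2 - p.2) / (q.1 - p.1)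

/-- value at abscissa `x` of the line through the edge `e` -/
noncomputable def ev (e : (ℝ × ℝ) × (ℝ × ℝ)) (x : ℝ) : ℝ := e.1.2 + sl e.1 e.2 * (x - e.1.1)

/-- the open segments intersect -/
def Meet (e f : (ℝ × ℝ) × (ℝ × ℝ)) : Prop :=
  ∃ x, e.1.1 < x ∧ x < e.2.1 ∧ f.1.1 < x ∧ x < f.2.1 ∧ ev e x = ev f x

/-- A geometric graph, with edges oriented left to right and no vertex inside an edge. -/
structure Geo (V : Finset (ℝ × ℝ)) (E : Finset ((ℝ × ℝ) × (ℝ × ℝ))) : Prop where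
  inj : ∀ p ∈ V, ∀ q ∈ V, p.1 = q.1 → p = q
  mem1 : ∀ e ∈ E, e.1 ∈ V
  mem2 : ∀ e ∈ E, e.2 ∈ V
  lt : ∀ e ∈ E, e.1.1 < e.2.1
  emp : ∀ e ∈ E, ∀ r ∈ V, e.1.1 < r.1 → r.1 < e.2.1 → ev e r.1 ≠ r.2

lemma sl_mul {p q : ℝ × ℝ} (h : p.1 < q.1) : sl p q * (q.1 - p.1) = q.2 - p.2 := by
  unfold sl
  have : q.1 - p.1 ≠ 0 := by linarith
  field_simp

lemma ev_left (e : (ℝ × ℝ) × (ℝ × ℝ)) : ev e e.1.1 = e.1.2 := by simp [ev]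

lemma ev_right {e : (ℝ × ℝ) × (ℝ × ℝ)} (h : e.1.1 < e.2.1) : ev e e.2.1 = e.2.2 := by
  simp [ev, sl_mul h]

lemma ev_le_iff {p r q : ℝ × ℝ} (h : p.1 < q.1) : ev (p, r) q.1 ≤ q.2 ↔ sl p r ≤ sl p q := by
  have h1 := sl_mul h
  have h2 : 0 < q.1 - p.1 := by linarith
  rw [← mul_le_mul_iff_left₀ (b := sl _ _) h2, h1]
  simp only [ev]
  constructor <;> intro h <;> linarith

lemma le_ev_iff {p r q : ℝ × ℝ} (h : p.1 < q.1) : q.2 ≤ ev (p, r) q.1 ↔ sl p q ≤ sl p r := by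
  have h1 := sl_mul h
  have h2 : 0 < q.1 - p.1 := by linarith
  rw [← mul_le_mul_iff_left₀ (b := sl _ _) h2, h1]
  simp only [ev]
  constructor <;> intro h <;> linarith

lemma ev_eq_iff {p r q : ℝ × ℝ} (h : p.1 < q.1) : ev (p, r) q.1 = q.2 ↔ sl p r = sl p q := by
  rw [le_antisymm_iff, ev_le_iff h, le_ev_iff h, ← le_antisymm_iff]

/-- affine crossing detection -/
lemma cross {e f : (ℝ × ℝ) × (ℝ × ℝ)} {x y : ℝ} (hxy : x < y)
    (h1 : e.1.1 ≤ x) (h2 : y ≤ e.2.1) (h3 : f.1.1 ≤ x) (h4 : y ≤ f.2.1)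
    (h5 : ev e x < ev f x) (h6 : ev f y < ev e y) : Meet e f := by
  have hc : ContinuousOn (fun z => ev e z - ev f z) (Set.Icc x y) := by
    unfold ev; fun_prop
  have := intermediate_value_Ioo hxy.le hc
  obtain ⟨z, hz, hz0⟩ := this (show (0 : ℝ) ∈ Set.Ioo _ _ from ⟨by linarith, by linarith⟩)
  simp only at hz0
  exact ⟨z, by linarith [hz.1], by linarith [hz.2], by linarith [hz.1], by linarith [hz.2],
    by linarith⟩

section
variable {V : Finset (ℝ × ℝ)} {E : Finset ((ℝ × ℝ) × (ℝ × ℝ))}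

/-- a vertex on an edge line, within range, is the right endpoint -/
lemma Geo.eq_right (G : Geo V E) {e} (he : e ∈ E) {q} (hq : q ∈ V) (h1 : e.1.1 < q.1)
    (h2 : q.1 ≤ e.2.1) (h3 : ev e q.1 = q.2) : q = e.2 := by
  rcases h2.lt_or_eq with h | h
  · exact absurd h3 (G.emp e he q hq h1 h)
  · exact G.inj q hq _ (G.mem2 e he) h

lemma Geo.same_slope (G : Geo V E) {e f} (he : e ∈ E) (hf : f ∈ E) (h : e.1 = f.1)
    (hs : sl e.1 e.2 = sl f.1 f.2) : e = f := by
  wlog hle : e.2.1 ≤ f.2.1 generalizing e f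
  · exact (this hf he h.symm hs.symm (le_of_not_ge hle)).symm
  have h1 := G.lt e he
  have : e.2 = f.2 := by
    apply G.eq_right hf (G.mem2 e he) (h ▸ h1) hle
    have := ev_right h1
    rw [← this]
    rw [h] at hs
    simp only [ev, h, hs]
  exact Prod.ext h this

/-- wedge data -/
def Wedge (V : Finset (ℝ × ℝ)) (E : Finset ((ℝ × ℝ) × (ℝ × ℝ))) (p r s q : ℝ × ℝ) : Prop :=
  (p, s) ∈ E ∧ sl p r < sl p s ∧ (∀ t, (p, t) ∈ E → sl p r < sl p t → sl p s ≤ sl p t) ∧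
  q ∈ V ∧ p.1 < q.1 ∧ sl p r ≤ sl p q ∧ sl p q ≤ sl p s ∧
  ∀ z ∈ V, p.1 < z.1 → sl p r ≤ sl p z → sl p z ≤ sl p s → q.1 ≤ z.1

lemma Geo.exists_wedge (G : Geo V E) {p r : ℝ × ℝ} (he : (p, r) ∈ E)
    (ht : ∃ f ∈ E, f.1 = p ∧ sl p r < sl f.1 f.2) : ∃ s q, Wedge V E p r s q := by
  classical
  obtain ⟨f, hf, hfp, hfs⟩ := ht
  obtain ⟨g, hg, hgm⟩ := (E.filter (fun g => g.1 = p ∧ sl p r < sl p g.2)).exists_min_image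
    (fun g => sl p g.2) ⟨f, by simp [hf, hfp]; rw [← hfp]; rw [← hfp] at hfs; exact hfs⟩
  simp only [Finset.mem_filter] at hg hgm
  obtain ⟨hgE, hgp, hgs⟩ := hg
  have hr := G.lt _ he
  obtain ⟨q, hq, hqm⟩ := (V.filter (fun z => p.1 < z.1 ∧ sl p r ≤ sl p z ∧
    sl p z ≤ sl p g.2)).exists_min_image (fun z => z.1)
    ⟨r, by simp only [Finset.mem_filter]; exact ⟨G.mem2 _ he, hr, le_rfl, hgs.le⟩⟩
  simp only [Finset.mem_filter] at hq hqm
  refine ⟨g.2, q, ?_, hgs, ?_, hq.1, hq.2.1, hq.2.2.1, hq.2.2.2, ?_⟩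
  · rw [← hgp]; exact hgE
  · intro t ht hts
    exact hgm (p, t) ⟨ht, rfl, hts⟩
  · intro z hz h1 h2 h3
    exact hqm z ⟨hz, h1, h2, h3⟩

lemma Geo.wedge_core (G : Geo V E) (nc : ∀ e ∈ E, ∀ f ∈ E, Meet e f → e = f)
    {p₁ r₁ s₁ p₂ r₂ s₂ q : ℝ × ℝ} (he₁ : (p₁, r₁) ∈ E) (he₂ : (p₂, r₂) ∈ E)
    (w₁ : Wedge V E p₁ r₁ s₁ q) (w₂ : Wedge V E p₂ r₂ s₂ q)
    (hq : q = r₁ ↔ q = r₂) (hp : p₁.1 < p₂.1) : False := by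
  obtain ⟨hs₁, hrs₁, -, hqV, hpq₁, ha₁, hb₁, hm₁⟩ := w₁
  obtain ⟨hs₂, hrs₂, -, -, hpq₂, ha₂, hb₂, hm₂⟩ := w₂
  have l₁ : q.1 ≤ r₁.1 := hm₁ _ (G.mem2 _ he₁) (G.lt _ he₁) le_rfl hrs₁.le
  have l₂ : q.1 ≤ r₂.1 := hm₂ _ (G.mem2 _ he₂) (G.lt _ he₂) le_rfl hrs₂.le
  have l₃ : q.1 ≤ s₁.1 := hm₁ _ (G.mem2 _ hs₁) (G.lt _ hs₁) hrs₁.le le_rfl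
  have l₄ : q.1 ≤ s₂.1 := hm₂ _ (G.mem2 _ hs₂) (G.lt _ hs₂) hrs₂.le le_rfl
  have n₁ : r₁ ≠ s₁ := by rintro rfl; exact lt_irrefl _ hrs₁
  have n₂ : r₂ ≠ s₂ := by rintro rfl; exact lt_irrefl _ hrs₂
  have hp2 := G.mem1 _ he₂
  rw [← ev_le_iff hpq₁] at ha₁
  rw [← ev_le_iff hpq₂] at ha₂
  rw [← le_ev_iff hpq₁] at hb₁
  rw [← le_ev_iff hpq₂] at hb₂
  have pn : p₁ ≠ p₂ := by rintro rfl; exact lt_irrefl _ hp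
  by_cases hA : sl p₁ r₁ ≤ sl p₁ p₂
  · by_cases hB : sl p₁ p₂ ≤ sl p₁ s₁
    · have := hm₁ p₂ hp2 hp hA hB
      linarith
    · rw [← le_ev_iff hp] at hB
      push Not at hB
      have hlt : ev (p₂, r₂) q.1 < ev (p₁, s₁) q.1 := by
        rcases (ha₂.trans hb₁).lt_or_eq with h | h
        · exact h
        · exfalso
          have e1 : ev (p₂, r₂) q.1 = q.2 := le_antisymm ha₂ (by linarith)
          have e2 : ev (p₁, s₁) q.1 = q.2 := le_antisymm (by linarith) hb₁
          have e3 := G.eq_right he₂ hqV hpq₂ l₂ e1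
          have e4 := G.eq_right hs₁ hqV hpq₁ l₃ e2
          exact n₁ ((hq.2 e3).symm.trans e4)
      have := nc _ hs₁ _ he₂ (cross (x := p₂.1) (y := q.1) hpq₂ hp.le l₃ le_rfl l₂
        (by rw [ev_left (p₂, r₂)]; exact hB) hlt)
      exact pn (congrArg Prod.fst this)
  · rw [← ev_le_iff hp] at hA
    push Not at hA
    have hlt : ev (p₁, r₁) q.1 < ev (p₂, s₂) q.1 := by
      rcases (ha₁.trans hb₂).lt_or_eq with h | h
      · exact h
      · exfalso
        have e1 : ev (p₁, r₁) q.1 = q.2 := le_antisymm ha₁ (by linarith)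
        have e2 : ev (p₂, s₂) q.1 = q.2 := le_antisymm (by linarith) hb₂
        have e3 := G.eq_right he₁ hqV hpq₁ l₁ e1
        have e4 := G.eq_right hs₂ hqV hpq₂ l₄ e2
        exact n₂ ((hq.1 e3).symm.trans e4)
    have := nc _ hs₂ _ he₁ (cross (x := p₂.1) (y := q.1) hpq₂ le_rfl l₄ hp.le l₁
        (by rw [ev_left (p₂, s₂)]; exact hA) hlt)
    exact pn (congrArg Prod.fst this).symm

lemma Geo.wedge_same (G : Geo V E)
    {p r₁ s₁ r₂ s₂ q : ℝ × ℝ} (he₂ : (p, r₂) ∈ E)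
    (w₁ : Wedge V E p r₁ s₁ q) (w₂ : Wedge V E p r₂ s₂ q)
    (hq : q = r₁ ↔ q = r₂) (h : sl p r₁ < sl p r₂) : False := by
  obtain ⟨hs₁, hrs₁, hmin, hqV, hpq₁, ha₁, hb₁, hm₁⟩ := w₁
  obtain ⟨hs₂, hrs₂, -, -, hpq₂, ha₂, hb₂, hm₂⟩ := w₂
  have l₂ : q.1 ≤ r₂.1 := hm₂ _ (G.mem2 _ he₂) (G.lt _ he₂) le_rfl hrs₂.le
  have l₃ : q.1 ≤ s₁.1 := hm₁ _ (G.mem2 _ hs₁) (G.lt _ hs₁) hrs₁.le le_rfl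
  have n₁ : r₁ ≠ s₁ := by rintro rfl; exact lt_irrefl _ hrs₁
  have h1 := hmin r₂ he₂ h
  have e1 : q = s₁ := G.eq_right hs₁ hqV hpq₁ l₃ ((ev_eq_iff hpq₁).2 (by linarith))
  have e2 : q = r₂ := G.eq_right he₂ hqV hpq₁ l₂ ((ev_eq_iff hpq₁).2 (by linarith))
  exact n₁ ((hq.2 e2).symm.trans e1)

lemma Geo.planar (G : Geo V E) (nc : ∀ e ∈ E, ∀ f ∈ E, Meet e f → e = f) :
    E.card ≤ 3 * V.card := by
  classical
  set T := E.filter (fun e => ∃ f ∈ E, f.1 = e.1 ∧ sl e.1 e.2 < sl f.1 f.2) with hT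
  set U := E.filter (fun e => ¬ ∃ f ∈ E, f.1 = e.1 ∧ sl e.1 e.2 < sl f.1 f.2) with hU
  have hTU : T.card + U.card = E.card := Finset.card_filter_add_card_filter_not _
  have h1 : U.card ≤ V.card := by
    apply Finset.card_le_card_of_injOn (fun e => e.1)
    · intro e he
      exact G.mem1 e (Finset.mem_filter.1 he).1
    · intro e he f hf hef
      simp only [hU, Finset.coe_filter, Set.mem_ofPred_eq] at he hf hef
      obtain ⟨he, he'⟩ := he
      obtain ⟨hf, hf'⟩ := hf
      push Not at he' hf'
      exact G.same_slope he hf hef (le_antisymm (hf' e he hef) (he' f hf hef.symm))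
  have hw : ∀ e ∈ T, ∃ s q, Wedge V E e.1 e.2 s q := by
    intro e he
    obtain ⟨h1, h2⟩ := Finset.mem_filter.1 he
    exact G.exists_wedge h1 h2
  choose! s q hsq using hw
  have h2 : T.card ≤ (V ×ˢ (Finset.univ : Finset Bool)).card := by
    apply Finset.card_le_card_of_injOn (fun e => (q e, decide (q e = e.2)))
    · intro e he
      have := (hsq e he).2.2.2.1
      exact Finset.mem_product.2 ⟨this, Finset.mem_univ _⟩
    · intro e he f hf hef
      have he' := hsq e he
      have hf' := hsq f hf
      have heE := (Finset.mem_filter.1 he).1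
      have hfE := (Finset.mem_filter.1 hf).1
      simp only [Prod.mk.injEq, decide_eq_decide] at hef
      obtain ⟨hq, hd⟩ := hef
      rw [← hq] at hf' hd
      rcases lt_trichotomy e.1.1 f.1.1 with h | h | h
      · exact (G.wedge_core nc heE hfE he' hf' hd h).elim
      · have hp := G.inj _ (G.mem1 _ heE) _ (G.mem1 _ hfE) h
        rcases lt_trichotomy (sl e.1 e.2) (sl f.1 f.2) with h' | h' | h'
        · rw [hp] at he' h'
          exact (G.wedge_same hfE he' hf' hd h').elim
        · exact G.same_slope heE hfE hp h'
        · rw [← hp] at hf' h'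
          exact (G.wedge_same heE hf' he' hd.symm h').elim
      · exact (G.wedge_core nc hfE heE hf' he' hd.symm h).elim
  simp at h2
  omega

end
end Beck

namespace Beck

open Classical in
/-- crossing pairs -/
noncomputable def X (E : Finset ((ℝ × ℝ) × (ℝ × ℝ))) :
    Finset (((ℝ × ℝ) × (ℝ × ℝ)) × ((ℝ × ℝ) × (ℝ × ℝ))) :=
  (E ×ˢ E).filter (fun ef => ef.1 ≠ ef.2 ∧ Meet ef.1 ef.2)

lemma mem_X {E : Finset ((ℝ × ℝ) × (ℝ × ℝ))} {ef} :
    ef ∈ X E ↔ (ef.1 ∈ E ∧ ef.2 ∈ E) ∧ ef.1 ≠ ef.2 ∧ Meet ef.1 ef.2 := by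
  simp [X]

lemma Geo.mono {V : Finset (ℝ × ℝ)} {E E' : Finset ((ℝ × ℝ) × (ℝ × ℝ))} (G : Geo V E)
    (h : E' ⊆ E) : Geo V E' :=
  ⟨G.inj, fun e he => G.mem1 e (h he), fun e he => G.mem2 e (h he), fun e he => G.lt e (h he),
    fun e he => G.emp e (h he)⟩

lemma Geo.linear {V : Finset (ℝ × ℝ)} (E : Finset ((ℝ × ℝ) × (ℝ × ℝ))) (G : Geo V E) :
    E.card ≤ 3 * V.card + (X E).card := by
  classical
  induction E using Finset.strongInduction with
  | H E ih =>
    by_cases h : ∀ e ∈ E, ∀ f ∈ E, Meet e f → e = f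
    · exact (G.planar h).trans (by omega)
    · push Not at h
      obtain ⟨e, he, f, hf, hm, hne⟩ := h
      have h1 := ih (E.erase e) (Finset.erase_ssubset he) (G.mono (Finset.erase_subset _ _))
      have h2 : (X (E.erase e)).card < (X E).card := by
        apply Finset.card_lt_card
        rw [Finset.ssubset_iff_of_subset]
        · refine ⟨(e, f), mem_X.2 ⟨⟨he, hf⟩, hne, hm⟩, ?_⟩
          simp [mem_X]
        · intro ef h
          rw [mem_X] at h ⊢
          exact ⟨⟨Finset.mem_of_mem_erase h.1.1, Finset.mem_of_mem_erase h.1.2⟩, h.2⟩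
      have h3 := Finset.card_erase_add_one he
      omega

open Classical in
/-- extend a colouring by zero -/
noncomputable def xt {V : Finset (ℝ × ℝ)} {m : ℕ} (f : V → Fin (m + 1)) (p : ℝ × ℝ) : Fin (m + 1) :=
  if h : p ∈ V then f ⟨p, h⟩ else 0

open Classical in
lemma count {V A : Finset (ℝ × ℝ)} (m : ℕ) (hA : A ⊆ V) :
    (Finset.univ.filter (fun f : V → Fin (m + 1) => ∀ p ∈ A, xt f p = 0)).card * (m + 1) ^ A.card
      = (m + 1) ^ V.card := by
  have h : (Finset.univ.filter (fun f : V → Fin (m + 1) => ∀ p ∈ A, xt f p = 0)) =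
      Fintype.piFinset (fun a : V => if a.1 ∈ A then {0} else Finset.univ) := by
    ext f
    simp only [Finset.mem_filter, Finset.mem_univ, true_and, Fintype.mem_piFinset]
    constructor
    · intro h a
      split_ifs with ha
      · have := h a.1 ha
        simp only [xt, a.2, dite_true] at this
        simp [this]
      · simp
    · intro h p hp
      have := h ⟨p, hA hp⟩
      simp only [hp, if_true, Finset.mem_singleton] at this
      simp [xt, hA hp, this]
  rw [h, Fintype.card_piFinset]
  have h1 : ∏ a : V, (if a.1 ∈ A then ({0} : Finset (Fin (m + 1))) else Finset.univ).card
      = ∏ a ∈ V, (if a ∈ A then 1 else (m + 1)) := by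
    rw [← Finset.prod_coe_sort V]
    apply Finset.prod_congr rfl
    intro a _
    split_ifs <;> simp
  have h2 : (m + 1) ^ A.card = ∏ a ∈ V, (if a ∈ A then (m + 1) else 1) := by
    rw [Finset.prod_ite_mem, Finset.inter_eq_right.2 hA, Finset.prod_const]
  rw [h1, h2, ← Finset.prod_mul_distrib, ← Finset.prod_const]
  apply Finset.prod_congr rfl
  intro a _
  split_ifs <;> simp

lemma Geo.distinct {V : Finset (ℝ × ℝ)} {E : Finset ((ℝ × ℝ) × (ℝ × ℝ))} (G : Geo V E)
    {e f} (he : e ∈ E) (hf : f ∈ E) (hne : e ≠ f) (hm : Meet e f) :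
    e.1 ≠ e.2 ∧ e.1 ≠ f.1 ∧ e.1 ≠ f.2 ∧ e.2 ≠ f.1 ∧ e.2 ≠ f.2 ∧ f.1 ≠ f.2 := by
  obtain ⟨x, h1, h2, h3, h4, h5⟩ := hm
  have he' := G.lt e he
  have hf' := G.lt f hf
  refine ⟨?_, ?_, ?_, ?_, ?_, ?_⟩
  · intro h; rw [h] at he'; exact lt_irrefl _ he'
  · intro h
    apply hne
    apply G.same_slope he hf h
    simp only [ev, h] at h5
    have : x - f.1.1 ≠ 0 := by linarith
    have h6 : sl f.1 e.2 * (x - f.1.1) = sl f.1 f.2 * (x - f.1.1) := by linarith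
    rw [h]
    exact mul_right_cancel₀ this h6
  · intro h; rw [h] at h1; linarith
  · intro h; rw [h] at h2; linarith
  · intro h
    have a1 := sl_mul he'
    have a2 := sl_mul hf'
    have hs : sl e.1 e.2 = sl f.1 f.2 := by
      simp only [ev] at h5
      have : e.2.1 - x ≠ 0 := by linarith
      apply mul_right_cancel₀ this
      rw [h] at a1 h5 ⊢
      linarith
    rcases lt_trichotomy e.1.1 f.1.1 with hl | hl | hl
    · apply G.emp e he f.1 (G.mem1 f hf) hl (by rw [h]; exact hf')
      simp only [ev]; rw [hs]; rw [hs, h] at a1; linarith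
    · exact hne (Prod.ext (G.inj _ (G.mem1 e he) _ (G.mem1 f hf) hl) h)
    · apply G.emp f hf e.1 (G.mem1 e he) hl (by rw [← h]; exact he')
      simp only [ev]; rw [hs, h] at a1; linarith
  · intro h; rw [h] at hf'; exact lt_irrefl _ hf'

open Classical in
lemma sum_count {ι : Type*} (S : Finset ι) {V : Finset (ℝ × ℝ)} (A : ι → Finset (ℝ × ℝ)) (m c : ℕ)
    (hA : ∀ i ∈ S, A i ⊆ V) (hc : ∀ i ∈ S, (A i).card = c) :
    (∑ f : V → Fin (m + 1), (S.filter (fun i => ∀ p ∈ A i, xt f p = 0)).card) * (m + 1) ^ c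
      = S.card * (m + 1) ^ V.card := by
  simp only [Finset.card_filter]
  rw [Finset.sum_comm, Finset.sum_mul, Finset.card_eq_sum_ones, Finset.sum_mul]
  apply Finset.sum_congr rfl
  intro i hi
  rw [← Finset.card_filter, ← hc i hi, count m (hA i hi), one_mul]

lemma Geo.amplify {V : Finset (ℝ × ℝ)} {E : Finset ((ℝ × ℝ) × (ℝ × ℝ))} (G : Geo V E) (m : ℕ) :
    E.card * (m + 1) ^ 2 ≤ 3 * V.card * (m + 1) ^ 3 + (X E).card := by
  classical
  have hE := sum_count E (V := V) (fun e => {e.1, e.2}) m 2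
    (by intro e he; simp [Finset.insert_subset_iff, G.mem1 e he, G.mem2 e he])
    (by
      intro e he
      apply Finset.card_pair
      intro h
      have := G.lt e he
      rw [h] at this
      exact lt_irrefl _ this)
  have hV := sum_count V (V := V) (fun e => {e}) m 1 (by simp) (by simp)
  have hX := sum_count (X E) (V := V) (fun e => {e.1.1, e.1.2, e.2.1, e.2.2}) m 4
    (by
      intro e he
      obtain ⟨⟨h1, h2⟩, -⟩ := mem_X.1 he
      simp [Finset.insert_subset_iff, G.mem1 _ h1, G.mem2 _ h1, G.mem1 _ h2, G.mem2 _ h2])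
    (by
      intro e he
      obtain ⟨⟨h1, h2⟩, h3, h4⟩ := mem_X.1 he
      obtain ⟨a, b, c, d, e, f⟩ := G.distinct h1 h2 h3 h4
      rw [Finset.card_insert_of_notMem, Finset.card_insert_of_notMem, Finset.card_insert_of_notMem,
        Finset.card_singleton] <;> simp [*])
  have key : ∀ f : V → Fin (m + 1),
      (E.filter (fun e => ∀ p ∈ ({e.1, e.2} : Finset (ℝ × ℝ)), xt f p = 0)).card ≤
      3 * (V.filter (fun e => ∀ p ∈ ({e} : Finset (ℝ × ℝ)), xt f p = 0)).card +
      ((X E).filter (fun e => ∀ p ∈ ({e.1.1, e.1.2, e.2.1, e.2.2} : Finset (ℝ × ℝ)),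
        xt f p = 0)).card := by
    intro f
    have G' : Geo (V.filter (fun e => ∀ p ∈ ({e} : Finset (ℝ × ℝ)), xt f p = 0))
        (E.filter (fun e => ∀ p ∈ ({e.1, e.2} : Finset (ℝ × ℝ)), xt f p = 0)) := by
      refine ⟨?_, ?_, ?_, ?_, ?_⟩
      · intro p hp q hq
        exact G.inj p (Finset.mem_filter.1 hp).1 q (Finset.mem_filter.1 hq).1
      · intro e he
        simp only [Finset.mem_filter, Finset.mem_insert, Finset.mem_singleton, forall_eq_or_imp,
          forall_eq] at he ⊢
        exact ⟨G.mem1 e he.1, he.2.1⟩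
      · intro e he
        simp only [Finset.mem_filter, Finset.mem_insert, Finset.mem_singleton, forall_eq_or_imp,
          forall_eq] at he ⊢
        exact ⟨G.mem2 e he.1, he.2.2⟩
      · intro e he
        exact G.lt e (Finset.mem_filter.1 he).1
      · intro e he r hr
        exact G.emp e (Finset.mem_filter.1 he).1 r (Finset.mem_filter.1 hr).1
    refine (G'.linear).trans (Nat.add_le_add_left (Finset.card_le_card ?_) _)
    intro ef h
    rw [mem_X] at h
    simp only [Finset.mem_filter, Finset.mem_insert, Finset.mem_singleton, forall_eq_or_imp,
          forall_eq, mem_X] at h ⊢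
    tauto
  have hs := Finset.sum_le_sum (fun f (_ : f ∈ Finset.univ) => key f)
  rw [Finset.sum_add_distrib, ← Finset.mul_sum] at hs
  generalize (∑ f : V → Fin (m + 1), (E.filter (fun e => ∀ p ∈ ({e.1, e.2} : Finset (ℝ × ℝ)), xt f p = 0)).card) = SE at *
  generalize (∑ f : V → Fin (m + 1), (V.filter (fun e => ∀ p ∈ ({e} : Finset (ℝ × ℝ)), xt f p = 0)).card) = SV at *
  generalize (∑ f : V → Fin (m + 1), ((X E).filter (fun e => ∀ p ∈ ({e.1.1, e.1.2, e.2.1, e.2.2} : Finset (ℝ × ℝ)),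
        xt f p = 0)).card) = SX at *
  have hpos : 0 < (m + 1) ^ V.card := by positivity
  refine Nat.le_of_mul_le_mul_right ?_ hpos
  calc E.card * (m + 1) ^ 2 * (m + 1) ^ V.card = SE * (m + 1) ^ 4 := by
        rw [mul_right_comm, ← hE]; ring
    _ ≤ (3 * SV + SX) * (m + 1) ^ 4 := Nat.mul_le_mul_right _ hs
    _ = 3 * (SV * (m + 1) ^ 1) * (m + 1) ^ 3 + SX * (m + 1) ^ 4 := by ring
    _ = _ := by rw [hV, hX]; ring

end Beck

namespace Beck

/-- line (slope, intercept) through an edge -/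
noncomputable def ln (e : (ℝ × ℝ) × (ℝ × ℝ)) : ℝ × ℝ := (sl e.1 e.2, e.1.2 - sl e.1 e.2 * e.1.1)

lemma ev_ln (e : (ℝ × ℝ) × (ℝ × ℝ)) (x : ℝ) : ev e x = (ln e).1 * x + (ln e).2 := by
  simp only [ev, ln]; ring

lemma ln_eq {l p q : ℝ × ℝ} (hp : p.2 = l.1 * p.1 + l.2) (hq : q.2 = l.1 * q.1 + l.2)
    (h : p.1 ≠ q.1) : ln (p, q) = l := by
  have h' : q.1 - p.1 ≠ 0 := sub_ne_zero.2 h.symm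
  have : sl p q = l.1 := by
    unfold sl; rw [div_eq_iff h', hp, hq]; ring
  apply Prod.ext
  · exact this
  · simp only [ln, this]; linarith

open Classical in
/-- points on a line -/
noncomputable def On (P : Finset (ℝ × ℝ)) (l : ℝ × ℝ) : Finset (ℝ × ℝ) :=
  P.filter (fun p => p.2 = l.1 * p.1 + l.2)

lemma mem_On {P : Finset (ℝ × ℝ)} {l p : ℝ × ℝ} : p ∈ On P l ↔ p ∈ P ∧ p.2 = l.1 * p.1 + l.2 := by
  simp [On]

lemma rich {P : Finset (ℝ × ℝ)} (inj : ∀ p ∈ P, ∀ q ∈ P, p.1 = q.1 → p = q)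
    (L : Finset (ℝ × ℝ)) (k : ℕ) (hL : ∀ l ∈ L, k < (On P l).card) (m : ℕ) :
    L.card * k * (m + 1) ^ 2 ≤ 3 * P.card * (m + 1) ^ 3 + L.card * L.card := by
  classical
  set E : Finset ((ℝ × ℝ) × (ℝ × ℝ)) := (P ×ˢ P).filter (fun e => e.1.1 < e.2.1 ∧ ln e ∈ L ∧
    ∀ r ∈ P, e.1.1 < r.1 → r.1 < e.2.1 → ev e r.1 ≠ r.2) with hE
  have memE : ∀ e, e ∈ E ↔ (e.1 ∈ P ∧ e.2 ∈ P) ∧ e.1.1 < e.2.1 ∧ ln e ∈ L ∧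
    ∀ r ∈ P, e.1.1 < r.1 → r.1 < e.2.1 → ev e r.1 ≠ r.2 := by
    intro e; simp [hE]
  have G : Geo P E := by
    refine ⟨inj, ?_, ?_, ?_, ?_⟩
    · intro e he; exact ((memE e).1 he).1.1
    · intro e he; exact ((memE e).1 he).1.2
    · intro e he; exact ((memE e).1 he).2.1
    · intro e he; exact ((memE e).1 he).2.2.2
  have uniq : ∀ e ∈ E, ∀ f ∈ E, ln e = ln f → ∀ x, e.1.1 < x → x < e.2.1 → f.1.1 < x →
      x < f.2.1 → e = f := by
    intro e he f hf hl x h1 h2 h3 h4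
    by_contra hne
    have hm : Meet e f := ⟨x, h1, h2, h3, h4, by rw [ev_ln, ev_ln, hl]⟩
    have key : ∀ e ∈ E, ∀ f ∈ E, e ≠ f → Meet e f → ln e = ln f → ¬ e.1.1 < f.1.1 := by
      intro e he f hf hne hm hl h
      obtain ⟨x, h1, h2, h3, h4, h5⟩ := hm
      apply G.emp e he f.1 (G.mem1 f hf) h (by linarith)
      rw [ev_ln, hl, ← ev_ln, ev_left]
    rcases lt_trichotomy e.1.1 f.1.1 with h | h | h
    · exact key e he f hf hne hm hl h
    · exact (G.distinct he hf hne hm).2.1 (inj _ (G.mem1 e he) _ (G.mem1 f hf) h)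
    · exact key f hf e he (Ne.symm hne) ⟨x, h3, h4, h1, h2, by rw [ev_ln, ev_ln, hl]⟩ hl.symm h
  have hX : (X E).card ≤ L.card * L.card := by
    rw [← Finset.card_product]
    apply Finset.card_le_card_of_injOn (fun ef => (ln ef.1, ln ef.2))
    · intro ef h
      obtain ⟨⟨h1, h2⟩, -⟩ := mem_X.1 h
      exact Finset.mem_product.2 ⟨((memE _).1 h1).2.2.1, ((memE _).1 h2).2.2.1⟩
    · rintro ⟨e, f⟩ h ⟨e', f'⟩ h' heq
      obtain ⟨⟨h1, h2⟩, h3, x, a1, a2, a3, a4, a5⟩ := mem_X.1 h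
      obtain ⟨⟨h1', h2'⟩, h3', x', a1', a2', a3', a4', a5'⟩ := mem_X.1 h'
      simp only [Prod.mk.injEq] at *
      obtain ⟨q1, q2⟩ := heq
      have hx : x = x' := by
        by_contra hx
        apply h3
        refine uniq e h1 f h2 ?_ x a1 a2 a3 a4
        rw [ev_ln, ev_ln] at a5 a5'
        rw [← q1, ← q2] at a5'
        have hz : ((ln e).1 - (ln f).1) * (x - x') = 0 := by linarith
        rcases mul_eq_zero.1 hz with hz | hz
        · have hz' : (ln e).1 = (ln f).1 := by linarith
          apply Prod.ext hz'
          rw [hz'] at a5; linarith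
        · exact absurd (by linarith) hx
      subst hx
      exact ⟨uniq e h1 e' h1' q1 x a1 a2 a1' a2', uniq f h2 f' h2' q2 x a3 a4 a3' a4'⟩
  have hEc : L.card * k ≤ E.card := by
    rw [Finset.card_eq_sum_card_fiberwise (f := ln) (t := L)
      (fun e he => ((memE e).1 he).2.2.1), ← smul_eq_mul]
    apply Finset.card_nsmul_le_sum
    intro l hl
    have hk := hL l hl
    have hne : (On P l).Nonempty := Finset.card_pos.1 (by omega)
    obtain ⟨M, hM, hMm⟩ := (On P l).exists_max_image (fun p => p.1) hne
    have hsucc : ∀ p ∈ (On P l).erase M, ∃ q, (p, q) ∈ E.filter (fun e => ln e = l) := by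
      intro p hp
      obtain ⟨hpM, hp⟩ := Finset.mem_erase.1 hp
      have hlt : p.1 < M.1 := lt_of_le_of_ne (hMm p hp) (fun h =>
        hpM (inj p (mem_On.1 hp).1 M (mem_On.1 hM).1 h))
      obtain ⟨q, hq, hqm⟩ := ((On P l).filter (fun q => p.1 < q.1)).exists_min_image
        (fun p => p.1) ⟨M, Finset.mem_filter.2 ⟨hM, hlt⟩⟩
      obtain ⟨hq, hpq⟩ := Finset.mem_filter.1 hq
      have hln : ln (p, q) = l := ln_eq (mem_On.1 hp).2 (mem_On.1 hq).2 hpq.ne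
      refine ⟨q, Finset.mem_filter.2 ⟨(memE _).2 ⟨⟨(mem_On.1 hp).1, (mem_On.1 hq).1⟩, hpq,
        hln ▸ hl, ?_⟩, hln⟩⟩
      intro r hr h1 h2 h3
      rw [ev_ln, hln] at h3
      have := hqm r (Finset.mem_filter.2 ⟨mem_On.2 ⟨hr, h3.symm⟩, h1⟩)
      exact absurd h2 (not_lt.2 this)
    choose! s hs using hsucc
    have h1 : ((On P l).erase M).card ≤ (E.filter (fun e => ln e = l)).card := by
      apply Finset.card_le_card_of_injOn (fun p => (p, s p))
      · intro p hp; exact hs p hp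
      · intro p _ q _ h; exact congrArg Prod.fst h
    rw [Finset.card_erase_of_mem hM] at h1
    omega
  have := G.amplify m
  calc L.card * k * (m + 1) ^ 2 ≤ E.card * (m + 1) ^ 2 := Nat.mul_le_mul_right _ hEc
    _ ≤ _ := this
    _ ≤ _ := by omega

lemma rich_real {n L k : ℕ} (hn : 0 < n) (hk : 0 < k)
    (h : ∀ m : ℕ, L * k * (m + 1) ^ 2 ≤ 3 * n * (m + 1) ^ 3 + L * L) :
    (k : ℝ) * L ≤ 288 * (n : ℝ) ^ 2 * ((k : ℝ) ^ 2)⁻¹ + 6 * n := by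
  have hn' : (0 : ℝ) < n := by exact_mod_cast hn
  have hk' : (0 : ℝ) < k := by exact_mod_cast hk
  have hpos : 0 ≤ 288 * (n : ℝ) ^ 2 * ((k : ℝ) ^ 2)⁻¹ := by positivity
  by_cases ha : (k : ℝ) * L < 6 * n
  · linarith
  push Not at ha
  set a : ℝ := k * L / (6 * n) with hadef
  have ha1 : 1 ≤ a := by rw [hadef, le_div_iff₀ (by positivity)]; linarith
  have haeq : a * (6 * n) = k * L := by rw [hadef]; field_simp
  obtain ⟨m, hm⟩ : ∃ m, ⌊a⌋₊ = m + 1 := Nat.exists_eq_succ_of_ne_zero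
    (by have := Nat.le_floor (n := 1) (by simpa using ha1); omega)
  have h1 := Nat.floor_le (by linarith : 0 ≤ a)
  have h2 := Nat.lt_floor_add_one a
  rw [hm] at h1 h2
  have hh : (L : ℝ) * k * ((m + 1 : ℕ) : ℝ) ^ 2 ≤ 3 * n * ((m + 1 : ℕ) : ℝ) ^ 3 + L * L := by
    exact_mod_cast h m
  have ht : (1 : ℝ) ≤ ((m + 1 : ℕ) : ℝ) := by push_cast; linarith [(Nat.cast_nonneg m : (0 : ℝ) ≤ m)]
  generalize ((m + 1 : ℕ) : ℝ) = t at *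
  have hLpos : (0 : ℝ) < L := by
    by_contra hc
    have : (L : ℝ) = 0 := le_antisymm (not_lt.1 hc) (Nat.cast_nonneg L)
    rw [this] at ha; linarith
  have h3 : 6 * n * t ≤ k * L := by nlinarith
  have h4 : k * L ≤ 12 * n * t := by nlinarith
  have h5 : L * k * t ^ 2 ≤ 2 * (L * L) := by nlinarith [mul_le_mul_of_nonneg_right h3 (sq_nonneg t)]
  have h6 : k * t ^ 2 ≤ 2 * L := by
    have : (L : ℝ) * (k * t ^ 2) ≤ L * (2 * L) := by linarith
    exact le_of_mul_le_mul_left this hLpos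
  have h7 : ((k : ℝ) * L) ^ 2 ≤ (12 * n * t) ^ 2 := by gcongr
  have h8 : (k : ℝ) * (k * L) ^ 2 ≤ 288 * n ^ 2 * L := by nlinarith [sq_nonneg (n : ℝ)]
  have h9 : (k : ℝ) * L * k ^ 2 ≤ 288 * n ^ 2 := by
    have : (L : ℝ) * (k * L * k ^ 2) ≤ L * (288 * n ^ 2) := by linarith
    exact le_of_mul_le_mul_left this hLpos
  have h10 : (k : ℝ) * L ≤ 288 * (n : ℝ) ^ 2 * ((k : ℝ) ^ 2)⁻¹ := by
    rw [← div_eq_mul_inv, le_div_iff₀ (by positivity)]; exact h9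
  linarith

end Beck

namespace Beck

lemma beck_inj {P : Finset (ℝ × ℝ)} (inj : ∀ p ∈ P, ∀ q ∈ P, p.1 = q.1 → p = q)
    (hn : 2 ≤ P.card) (hP : ∀ l, 120 * (On P l).card ≤ P.card) :
    ∃ L : Finset (ℝ × ℝ), (∀ l ∈ L, 2 ≤ (On P l).card) ∧
      (P.card : ℝ) ^ 2 / (10 * 11520 ^ 2) ≤ L.card := by
  classical
  set n := P.card with hndef
  set L := P.offDiag.image ln with hLdef
  have honp : ∀ p ∈ P, ∀ q ∈ P, p ≠ q → p ∈ On P (ln (p, q)) ∧ q ∈ On P (ln (p, q)) := by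
    intro p hp q hq hpq
    have h1 : p.1 ≠ q.1 := fun h => hpq (inj p hp q hq h)
    have h' : q.1 - p.1 ≠ 0 := sub_ne_zero.2 h1.symm
    have h2 : sl p q * (q.1 - p.1) = q.2 - p.2 := by unfold sl; field_simp
    refine ⟨mem_On.2 ⟨hp, ?_⟩, mem_On.2 ⟨hq, ?_⟩⟩
    · simp only [ln]; ring
    · simp only [ln]; linarith
  refine ⟨L, ?_, ?_⟩
  · intro l hl
    obtain ⟨⟨p, q⟩, hpq, rfl⟩ := Finset.mem_image.1 hl
    obtain ⟨hp, hq, hne⟩ := Finset.mem_offDiag.1 hpq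
    obtain ⟨h1, h2⟩ := honp p hp q hq hne
    exact Finset.one_lt_card.2 ⟨p, h1, q, h2, hne⟩
  set M := n / 120 with hM
  have hMle : ∀ l, (On P l).card ≤ M := by
    intro l
    have := hP l
    omega
  -- pair counting
  have hpairs : n * n - n ≤ ∑ k ∈ Finset.range M,
      2 * (k * (L.filter (fun l => k < (On P l).card)).card) := by
    calc n * n - n = P.offDiag.card := (Finset.offDiag_card P).symm
      _ = ∑ l ∈ L, (P.offDiag.filter (fun e => ln e = l)).card :=
          Finset.card_eq_sum_card_fiberwise (fun e he => Finset.mem_image_of_mem _ he)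
      _ ≤ ∑ l ∈ L, (On P l).offDiag.card := by
          apply Finset.sum_le_sum
          intro l _
          apply Finset.card_le_card
          rintro ⟨p, q⟩ h
          obtain ⟨h0, rfl⟩ := Finset.mem_filter.1 h
          obtain ⟨hp, hq, hne⟩ := Finset.mem_offDiag.1 h0
          obtain ⟨h1, h2⟩ := honp p hp q hq hne
          exact Finset.mem_offDiag.2 ⟨h1, h2, hne⟩
      _ = ∑ l ∈ L, ∑ k ∈ Finset.range M, (if k < (On P l).card then 2 * k else 0) := by
          apply Finset.sum_congr rfl
          intro l _
          rw [← Finset.sum_filter, Finset.offDiag_card]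
          have : (Finset.range M).filter (fun k => k < (On P l).card)
              = Finset.range (On P l).card := by
            ext k
            have := hMle l
            simp only [Finset.mem_filter, Finset.mem_range]
            omega
          rw [this, ← Finset.mul_sum, mul_comm 2, Finset.sum_range_id_mul_two, Nat.mul_sub_one]
      _ = _ := by
          rw [Finset.sum_comm]
          apply Finset.sum_congr rfl
          intro k _
          rw [← Finset.sum_filter, Finset.sum_const, smul_eq_mul]
          ring
  have hn0 : (2 : ℝ) ≤ n := by exact_mod_cast hn
  have hpairsR : (n : ℝ) * n - n ≤ ∑ k ∈ Finset.range M,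
      2 * ((k : ℝ) * (L.filter (fun l => k < (On P l).card)).card) := by
    have : n * n ≤ (∑ k ∈ Finset.range M,
      2 * (k * (L.filter (fun l => k < (On P l).card)).card)) + n := by omega
    have h2 : ((n * n : ℕ) : ℝ) ≤ (((∑ k ∈ Finset.range M,
      2 * (k * (L.filter (fun l => k < (On P l).card)).card)) + n : ℕ) : ℝ) := by exact_mod_cast this
    push_cast at h2
    linarith
  obtain ⟨K, hK⟩ : ∃ K : ℕ, K = 11520 := ⟨_, rfl⟩
  have hKR : (K : ℝ) = 11520 := by rw [hK]; norm_num
  have hterm : ∀ k ∈ Finset.range M,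
      2 * ((k : ℝ) * (L.filter (fun l => k < (On P l).card)).card) ≤
      (if k < K then 2 * (K : ℝ) * L.card else 0) +
      (if K - 1 < k then 576 * (n : ℝ) ^ 2 * ((k : ℝ) ^ 2)⁻¹ else 0) + 12 * n := by
    intro k _
    by_cases hk : k < K
    · have h1 : ¬ (K - 1 < k) := by omega
      rw [if_pos hk, if_neg h1]
      have h2 : ((L.filter (fun l => k < (On P l).card)).card : ℝ) ≤ L.card := by
        exact_mod_cast Finset.card_filter_le _ _
      have h3 : (k : ℝ) ≤ K := by exact_mod_cast hk.le
      have h4 : (k : ℝ) * (L.filter (fun l => k < (On P l).card)).card ≤ K * L.card := by gcongr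
      linarith
    · have h1 : K - 1 < k := by omega
      rw [if_neg hk, if_pos h1]
      have := rich_real (n := n) (L := (L.filter (fun l => k < (On P l).card)).card) (k := k)
        (by omega) (by omega)
        (rich inj _ k (fun l hl => (Finset.mem_filter.1 hl).2))
      linarith
  have hsum := hpairsR.trans (Finset.sum_le_sum hterm)
  rw [Finset.sum_add_distrib, Finset.sum_add_distrib] at hsum
  have s1 : ∑ k ∈ Finset.range M, (if k < K then 2 * (K : ℝ) * L.card else 0)
      ≤ K * (2 * (K : ℝ) * L.card) := by
    rw [← Finset.sum_filter, Finset.sum_const, nsmul_eq_mul]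
    apply mul_le_mul_of_nonneg_right _ (by positivity)
    have : ((Finset.range M).filter (fun k => k < K)).card ≤ (Finset.range K).card := by
      apply Finset.card_le_card
      intro k hk
      exact Finset.mem_range.2 (Finset.mem_filter.1 hk).2
    rw [Finset.card_range] at this
    exact_mod_cast this
  have s2 : ∑ k ∈ Finset.range M, (if K - 1 < k then 576 * (n : ℝ) ^ 2 * ((k : ℝ) ^ 2)⁻¹ else 0)
      ≤ 576 * (n : ℝ) ^ 2 * (2 / 11520) := by
    rw [← Finset.sum_filter, ← Finset.mul_sum]
    apply mul_le_mul_of_nonneg_left _ (by positivity)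
    have : (Finset.range M).filter (fun k => K - 1 < k) = Finset.Ioo (K - 1) M := by
      ext k; simp only [Finset.mem_filter, Finset.mem_range, Finset.mem_Ioo]; tauto
    rw [this]
    refine (sum_Ioo_inv_sq_le (K - 1) M).trans (le_of_eq ?_)
    rw [hK]; norm_num
  have s3 : ∑ k ∈ Finset.range M, (12 * (n : ℝ)) ≤ n ^ 2 / 10 := by
    rw [Finset.sum_const, Finset.card_range, nsmul_eq_mul]
    have : (M : ℝ) * 120 ≤ n := by exact_mod_cast Nat.div_mul_le_self n 120
    nlinarith
  rw [hKR] at s1 hsum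
  rw [div_le_iff₀ (by norm_num)]
  have hq : (n : ℝ) ≤ n ^ 2 / 2 := by nlinarith
  have hfin := hsum.trans (add_le_add (add_le_add s1 s2) s3)
  have hLnn : (0 : ℝ) ≤ L.card := Nat.cast_nonneg _
  clear hsum s1 s2 s3 hterm hpairsR hpairs
  norm_num at hfin ⊢
  linarith

lemma exists_shear (P : Finset (ℝ × ℝ)) :
    ∃ t : ℝ, ∀ p ∈ P, ∀ q ∈ P, p.1 + t * p.2 = q.1 + t * q.2 → p = q := by
  classical
  obtain ⟨t, ht⟩ := Infinite.exists_notMem_finset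
    ((P ×ˢ P).image (fun e => -(e.1.1 - e.2.1) / (e.1.2 - e.2.2)))
  refine ⟨t, fun p hp q hq h => ?_⟩
  by_contra hne
  by_cases h2 : p.2 = q.2
  · rw [h2] at h
    exact hne (Prod.ext (by linarith) h2)
  · apply ht
    refine Finset.mem_image.2 ⟨(p, q), Finset.mem_product.2 ⟨hp, hq⟩, ?_⟩
    have : p.2 - q.2 ≠ 0 := sub_ne_zero.2 h2
    simp only
    rw [div_eq_iff this]
    linarith

/-- line pulled back by the shear -/
def pull (t : ℝ) (l : ℝ × ℝ) : Set (ℝ × ℝ) := {p | l.1 * p.1 + (l.1 * t - 1) * p.2 = -l.2}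

lemma mem_pull {t : ℝ} {l p : ℝ × ℝ} : p ∈ pull t l ↔ p.2 = l.1 * (p.1 + t * p.2) + l.2 := by
  change l.1 * p.1 + (l.1 * t - 1) * p.2 = -l.2 ↔ _
  constructor <;> intro h <;> linarith

lemma isLine_pull (t : ℝ) (l : ℝ × ℝ) : IsLine (pull t l) := by
  refine ⟨l.1, l.1 * t - 1, -l.2, ?_, rfl⟩
  intro h
  simp only [Prod.mk.injEq] at h
  rw [h.1] at h
  norm_num at h

lemma pull_inj (t : ℝ) : Function.Injective (pull t) := by
  intro l l' h
  have h1 : l.2 = l'.2 := by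
    have : ((-(t * l.2), l.2) : ℝ × ℝ) ∈ pull t l := by rw [mem_pull]; simp
    rw [h, mem_pull] at this
    simpa using this
  have h2 : l.1 + l.2 = l'.1 + l'.2 := by
    have : ((1 - t * (l.1 + l.2), l.1 + l.2) : ℝ × ℝ) ∈ pull t l := by rw [mem_pull]; simp
    rw [h, mem_pull] at this
    simpa using this
  exact Prod.ext (by linarith) h1

lemma line_sub {ℓ ℓ' : Set (ℝ × ℝ)} (h : IsLine ℓ) (h' : IsLine ℓ') {p q : ℝ × ℝ} (hne : p ≠ q)
    (hp : p ∈ ℓ) (hq : q ∈ ℓ) (hp' : p ∈ ℓ') (hq' : q ∈ ℓ') : ℓ ⊆ ℓ' := by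
  obtain ⟨a, b, c, hab, rfl⟩ := h
  obtain ⟨a', b', c', hab', rfl⟩ := h'
  intro z hz
  change a * p.1 + b * p.2 = c at hp
  change a * q.1 + b * q.2 = c at hq
  change a * z.1 + b * z.2 = c at hz
  change a' * p.1 + b' * p.2 = c' at hp'
  change a' * q.1 + b' * q.2 = c' at hq'
  change a' * z.1 + b' * z.2 = c'
  have hdet : a * b' - a' * b = 0 := by
    by_contra hd
    apply hne
    have e1 : a * (p.1 - q.1) + b * (p.2 - q.2) = 0 := by linarith
    have e2 : a' * (p.1 - q.1) + b' * (p.2 - q.2) = 0 := by linarith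
    have f1 : (a * b' - a' * b) * (p.1 - q.1) = 0 := by linear_combination b' * e1 - b * e2
    have f2 : (a * b' - a' * b) * (p.2 - q.2) = 0 := by linear_combination a * e2 - a' * e1
    have g1 := (mul_eq_zero.1 f1).resolve_left hd
    have g2 := (mul_eq_zero.1 f2).resolve_left hd
    exact Prod.ext (by linarith) (by linarith)
  have e1 : a * (z.1 - p.1) + b * (z.2 - p.2) = 0 := by linarith
  suffices hs : a' * (z.1 - p.1) + b' * (z.2 - p.2) = 0 by linarith
  by_cases ha : a = 0
  · have hb : b ≠ 0 := by rintro rfl; exact hab (by rw [ha])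
    apply mul_left_cancel₀ hb
    linear_combination b' * e1 - (z.1 - p.1) * hdet
  · apply mul_left_cancel₀ ha
    linear_combination a' * e1 + (z.2 - p.2) * hdet

lemma finite_lines (P : Finset (ℝ × ℝ)) :
    {ℓ : Set (ℝ × ℝ) | IsLine ℓ ∧ 2 ≤ ((P : Set (ℝ × ℝ)) ∩ ℓ).ncard}.Finite := by
  apply Set.Finite.of_finite_image (f := fun ℓ => (P : Set (ℝ × ℝ)) ∩ ℓ)
  · apply Set.Finite.subset (P.finite_toSet.finite_subsets)
    rintro _ ⟨ℓ, -, rfl⟩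
    exact Set.inter_subset_left
  · rintro ℓ ⟨h1, h2⟩ ℓ' ⟨h1', h2'⟩ heq
    simp only at heq
    obtain ⟨p, hp, q, hq, hne⟩ := (Set.one_lt_ncard (P.finite_toSet.inter_of_left _)).1 h2
    have hp' := hp
    have hq' := hq
    rw [heq] at hp' hq'
    exact Set.Subset.antisymm (line_sub h1 h1' hne hp.2 hq.2 hp'.2 hq'.2)
      (line_sub h1' h1 hne hp'.2 hq'.2 hp.2 hq.2)

end Beck

/-- Beck's theorem. -/
theorem beck_theorem :
    ∃ c C : ℝ, 1 ≤ c ∧ 0 < C ∧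
      ∀ P : Finset (ℝ × ℝ),
        (∃ ℓ : Set (ℝ × ℝ), IsLine ℓ ∧
            (P.card : ℝ) / c ≤ (((P : Set (ℝ × ℝ)) ∩ ℓ).ncard : ℝ)) ∨
        (P.card : ℝ) ^ 2 / C ≤
          ({ℓ : Set (ℝ × ℝ) | IsLine ℓ ∧ 2 ≤ ((P : Set (ℝ × ℝ)) ∩ ℓ).ncard}.ncard : ℝ) := by
  classical
  refine ⟨120, 10 * 11520 ^ 2, by norm_num, by norm_num, fun P => ?_⟩
  rw [or_iff_not_imp_left]
  intro hno
  push Not at hno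
  obtain ⟨t, ht⟩ := Beck.exists_shear P
  set sh : ℝ × ℝ → ℝ × ℝ := fun p => (p.1 + t * p.2, p.2) with hsh
  have shinj : Set.InjOn sh P := by
    intro p hp q hq h
    exact ht p hp q hq (congrArg Prod.fst h)
  set Q := P.image sh with hQ
  have hcard : Q.card = P.card := Finset.card_image_of_injOn shinj
  have hon : ∀ l, ((P : Set (ℝ × ℝ)) ∩ Beck.pull t l).ncard = (Beck.On Q l).card := by
    intro l
    have : (P : Set (ℝ × ℝ)) ∩ Beck.pull t l
        = ((P.filter (fun p => p ∈ Beck.pull t l) : Finset (ℝ × ℝ)) : Set (ℝ × ℝ)) := by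
      ext p; simp
    rw [this, Set.ncard_coe_finset]
    rw [← Finset.card_image_of_injOn (f := sh)
      (shinj.mono (by intro p hp; exact (Finset.mem_filter.1 hp).1))]
    congr 1
    ext q
    simp only [Beck.mem_On, hQ, Finset.mem_image, Finset.mem_filter, Beck.mem_pull]
    constructor
    · rintro ⟨p, ⟨hp, h⟩, rfl⟩
      exact ⟨⟨p, hp, rfl⟩, h⟩
    · rintro ⟨⟨p, hp, rfl⟩, h⟩
      exact ⟨p, ⟨hp, h⟩, rfl⟩
  have hQinj : ∀ p ∈ Q, ∀ q ∈ Q, p.1 = q.1 → p = q := by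
    intro p hp q hq h
    obtain ⟨p', hp', rfl⟩ := Finset.mem_image.1 hp
    obtain ⟨q', hq', rfl⟩ := Finset.mem_image.1 hq
    rw [ht p' hp' q' hq' h]
  have hrich : ∀ l, ((Beck.On Q l).card : ℝ) * 120 < P.card := by
    intro l
    have := hno _ (Beck.isLine_pull t l)
    rw [hon, lt_div_iff₀ (by norm_num)] at this
    exact this
  have hne : P.Nonempty := by
    rw [← Finset.card_pos]
    have := hrich 0
    have h2 : (0 : ℝ) < P.card := lt_of_le_of_lt (by positivity) this
    exact_mod_cast h2
  have hn2 : 2 ≤ Q.card := by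
    obtain ⟨p, hp⟩ := hne
    have h1 := hrich (0, p.2)
    have h2 : 0 < (Beck.On Q (0, p.2)).card := by
      apply Finset.card_pos.2
      exact ⟨sh p, Beck.mem_On.2 ⟨Finset.mem_image_of_mem _ hp, by simp [hsh]⟩⟩
    have h3 : (Beck.On Q (0, p.2)).card * 120 < P.card := by exact_mod_cast h1
    omega
  obtain ⟨L, hL, hLc⟩ := Beck.beck_inj hQinj hn2 (by
    intro l
    have h3 : (Beck.On Q l).card * 120 < P.card := by exact_mod_cast hrich l
    omega)
  rw [hcard] at hLc
  refine hLc.trans ?_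
  have : (L.image (Beck.pull t)).card = L.card :=
    Finset.card_image_of_injective _ (Beck.pull_inj t)
  rw [← this, ← Set.ncard_coe_finset]
  have hsub : ((L.image (Beck.pull t) : Finset (Set (ℝ × ℝ))) : Set (Set (ℝ × ℝ))) ⊆
      {ℓ : Set (ℝ × ℝ) | IsLine ℓ ∧ 2 ≤ ((P : Set (ℝ × ℝ)) ∩ ℓ).ncard} := by
    intro ℓ hℓ
    obtain ⟨l, hl, rfl⟩ := Finset.mem_image.1 hℓ
    refine ⟨Beck.isLine_pull t l, ?_⟩
    rw [hon]
    exact hL l hl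
  exact_mod_cast Set.ncard_le_ncard hsub (Beck.finite_lines P)
end

section
/- (Main construction) For every positive integer k that is not a perfect square there exist constants c₀ > 0 and N₀ such that for every natural number N ≥ N₀ and every integer r with 2 ≤ r ≤ N, setting P = A_N × A_N, there exists a finite set L_r of lines in ℝ² such that every line in L_r contains at least r points of P, and |L_r| ≥ c₀·(|P|²/r³ + |P|/r). -/
/-- `A_N = { x₁ + x₂·√k : x₁, x₂ ∈ ℤ, |x₁| ≤ √N, |x₂| ≤ √N }`. -/
def aSet (k N : ℕ) : Set ℝ :=
  {x : ℝ | ∃ x₁ x₂ : ℤ, |(x₁ : ℝ)| ≤ Real.sqrt N ∧ |(x₂ : ℝ)| ≤ Real.sqrt N ∧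
    x = (x₁ : ℝ) + (x₂ : ℝ) * Real.sqrt k}


/-- Height. -/
def hgt {d : ℤ} (x : ℤ√d) : ℕ := max x.re.natAbs x.im.natAbs

/-- Box. -/
noncomputable def box (d α β : ℤ) (L : ℕ) : Finset (ℤ√d) :=
  (Finset.Ico α (α + L) ×ˢ Finset.Ico β (β + L)).map
    ⟨fun ab => (⟨ab.1, ab.2⟩ : ℤ√d), fun x y h => by
      have := congrArg Zsqrtd.re h; have := congrArg Zsqrtd.im h
      exact Prod.ext ‹_› ‹_›⟩

lemma mem_box {d α β : ℤ} {L : ℕ} {x : ℤ√d} :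
    x ∈ box d α β L ↔ (α ≤ x.re ∧ x.re < α + L) ∧ (β ≤ x.im ∧ x.im < β + L) := by
  simp only [box, Finset.mem_map, Finset.mem_product, Finset.mem_Ico]
  constructor
  · rintro ⟨a, h, rfl⟩; exact h
  · intro h; exact ⟨(x.re, x.im), h, rfl⟩

lemma card_box (d α β : ℤ) (L : ℕ) : (box d α β L).card = L * L := by
  simp [box]

/-- Ball. -/
noncomputable def ball (d : ℤ) (H : ℕ) : Finset (ℤ√d) := box d (-H) (-H) (2 * H + 1)

lemma mem_ball {d : ℤ} {H : ℕ} {x : ℤ√d} : x ∈ ball d H ↔ hgt x ≤ H := by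
  simp only [ball, mem_box, hgt, max_le_iff]; push_cast; omega

lemma card_ball (d : ℤ) (H : ℕ) : (ball d H).card = (2 * H + 1) * (2 * H + 1) := card_box _ _ _ _

lemma hgt_pos {d : ℤ} {x : ℤ√d} (hx : x ≠ 0) : 0 < hgt x := by
  rw [Nat.pos_iff_ne_zero]
  intro h
  apply hx
  simp only [hgt] at h
  ext
  · simp; omega
  · simp; omega

lemma hgt_add {d : ℤ} (x y : ℤ√d) : hgt (x + y) ≤ hgt x + hgt y := by
  simp only [hgt, Zsqrtd.re_add, Zsqrtd.im_add]; omega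

lemma hgt_mul {k : ℕ} (hk : 0 < k) (x y : ℤ√(k : ℤ)) : hgt (x * y) ≤ (k + 1) * (hgt x * hgt y) := by
  have h1 : x.re.natAbs ≤ hgt x := le_max_left _ _
  have h2 : x.im.natAbs ≤ hgt x := le_max_right _ _
  have h3 : y.re.natAbs ≤ hgt y := le_max_left _ _
  have h4 : y.im.natAbs ≤ hgt y := le_max_right _ _
  apply max_le
  · rw [Zsqrtd.re_mul]
    refine (Int.natAbs_add_le _ _).trans ?_
    simp only [Int.natAbs_mul, Int.natAbs_natCast]
    have := Nat.mul_le_mul h1 h3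
    have := Nat.mul_le_mul_left k (Nat.mul_le_mul h2 h4)
    nlinarith
  · rw [Zsqrtd.im_mul]
    refine (Int.natAbs_add_le _ _).trans ?_
    simp only [Int.natAbs_mul]
    have := Nat.mul_le_mul h1 h4
    have := Nat.mul_le_mul h2 h3
    nlinarith [Nat.zero_le (hgt x * hgt y)]

/-- The direction `(q,p)` has no representative of height below `w`. -/
def Good {d : ℤ} (g : (ℤ√d) × (ℤ√d)) (w : ℕ) : Prop :=
  ∀ q' p' : ℤ√d, q' ≠ 0 → g.1 * p' = g.2 * q' → w ≤ hgt q'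

lemma pig {k : ℕ} [Zsqrtd.Nonsquare k] (S : Finset ((ℤ√(k : ℤ)) × (ℤ√(k : ℤ)))) (g : (ℤ√(k : ℤ)) × (ℤ√(k : ℤ)))
    (hq : g.1 ≠ 0) (w : ℕ) (hw : 0 < w) (hg : Good g w) (α β : ℤ) (L : ℕ)
    (hS : ∀ z ∈ S, z.1 ∈ box k α β L)
    (hS' : ∀ z ∈ S, ∀ z' ∈ S, g.1 * (z.2 - z'.2) = g.2 * (z.1 - z'.1)) :
    S.card ≤ (L / w + 1) * (L / w + 1) := by
  have : (Finset.range (L / w + 1) ×ˢ Finset.range (L / w + 1)).card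
    = (L / w + 1) * (L / w + 1) := by simp
  rw [← this]
  apply Finset.card_le_card_of_injOn
    (fun z => ((z.1.re - α).toNat / w, (z.1.im - β).toNat / w))
  · intro z hz
    have := mem_box.1 (hS z hz)
    simp only [Finset.coe_product, Set.mem_prod, Finset.mem_coe, Finset.mem_range, Nat.lt_succ_iff]
    constructor <;> apply Nat.div_le_div_right <;> omega
  · intro z hz z' hz' h
    have b1 := mem_box.1 (hS z hz)
    have b2 := mem_box.1 (hS z' hz')
    have h3 := hS' z hz z' hz'
    by_cases h0 : z.1 - z'.1 = 0
    · rw [h0, mul_zero, mul_eq_zero] at h3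
      exact Prod.ext (sub_eq_zero.1 h0) (sub_eq_zero.1 (h3.resolve_left hq))
    · exfalso
      have h4 := hg _ _ h0 h3
      simp only [Prod.mk.injEq] at h
      obtain ⟨e1, e2⟩ := h
      have aux : ∀ a b : ℕ, a / w = b / w → a < b + w ∧ b < a + w := by
        intro a b e
        have x1 := Nat.div_add_mod a w
        have x2 := Nat.div_add_mod b w
        have x3 := Nat.mod_lt a hw
        have x4 := Nat.mod_lt b hw
        rw [e] at x1
        omega
      have a1 := aux _ _ e1
      have a2 := aux _ _ e2
      simp only [hgt, Zsqrtd.re_sub, Zsqrtd.im_sub] at h4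
      omega

/-- real embedding -/
noncomputable def emb (k : ℕ) : ℤ√(k : ℤ) →+* ℝ := Zsqrtd.toReal (Int.natCast_nonneg k)

lemma emb_apply (k : ℕ) (x : ℤ√(k : ℤ)) : emb k x = x.re + x.im * Real.sqrt k := by
  simp [emb, Zsqrtd.toReal, Zsqrtd.lift]

lemma emb_inj (k : ℕ) [h : Zsqrtd.Nonsquare k] : Function.Injective (emb k) :=
  Zsqrtd.toReal_injective _ (fun n hn => by
    apply h.ns n.natAbs
    zify
    rw [hn]; simp)

lemma bal_real {P Q P0 Q0 : ℝ} (hQ : |P| ≤ |Q|) (h0 : 0 < |Q|) (h : Q0 * P = P0 * Q) : |P0| ≤ |Q0| := by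
  have : |Q0| * |P| = |P0| * |Q| := by rw [← abs_mul, ← abs_mul, h]
  by_contra hc
  push Not at hc
  nlinarith [abs_nonneg P, abs_nonneg Q0]

lemma bal {k : ℕ} (hk : 0 < k) (m : ℕ) (q p q0 p0 : ℤ√(k : ℤ)) (hq : q ∈ box k (3 * k * m) 0 m)
    (hp : p ∈ box k 0 0 m) (h : q0 * p = p0 * q) : hgt p0 ≤ (k + 1) * hgt q0 := by
  rw [mem_box] at hq hp
  obtain ⟨⟨a1, a2⟩, a3, a4⟩ := hq
  obtain ⟨⟨b1, b2⟩, b3, b4⟩ := hp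
  have e1 := congrArg (emb k) h
  have e2 := congrArg (fun x => emb k (star x)) h
  simp only [map_mul, star_mul, emb_apply, Zsqrtd.re_star, Zsqrtd.im_star] at e1 e2
  have s1 : 1 ≤ Real.sqrt k := by
    rw [Real.one_le_sqrt]; exact_mod_cast hk
  have hk' : (1 : ℝ) ≤ k := by exact_mod_cast hk
  have s2 : Real.sqrt k ≤ k := by
    rw [Real.sqrt_le_left (by positivity)]; nlinarith
  have s0 : 0 ≤ Real.sqrt k := by positivity
  set s := Real.sqrt k with hs
  have A1 : (3 * k * m : ℝ) ≤ q.re := by exact_mod_cast a1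
  have A2 : (q.re : ℝ) < 3 * k * m + m := by exact_mod_cast a2
  have A3 : (0 : ℝ) ≤ q.im := by exact_mod_cast a3
  have A4 : (q.im : ℝ) < m := by have := a4; rw [zero_add] at this; exact_mod_cast this
  have B1 : (0 : ℝ) ≤ p.re := by exact_mod_cast b1
  have B2 : (p.re : ℝ) < m := by have := b2; rw [zero_add] at this; exact_mod_cast this
  have B3 : (0 : ℝ) ≤ p.im := by exact_mod_cast b3
  have B4 : (p.im : ℝ) < m := by have := b4; rw [zero_add] at this; exact_mod_cast this
  have m0 : (0 : ℝ) < m := by linarith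
  have qs : q.im * s ≤ k * m := by nlinarith
  have ps : p.im * s ≤ k * m := by nlinarith
  have km : (m : ℝ) ≤ k * m := by nlinarith
  have qs0 : 0 ≤ q.im * s := by positivity
  have ps0 : 0 ≤ p.im * s := by positivity
  push_cast at e2
  have r1 := bal_real (P := p.re + p.im * s) (Q := q.re + q.im * s) (by
    rw [abs_of_nonneg (by linarith : 0 ≤ q.re + q.im * s), abs_le]
    constructor <;> linarith) (by rw [abs_pos]; linarith) e1
  have r2 := bal_real (P := p.re + (-p.im) * s) (Q := q.re + (-q.im) * s) 
    (P0 := p0.re + (-p0.im) * s) (Q0 := q0.re + (-q0.im) * s) (by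
    rw [abs_of_nonneg (by linarith : 0 ≤ q.re + (-q.im) * s), abs_le]
    constructor <;> linarith) (by rw [abs_pos]; linarith) (by linarith)
  have H1 : |(q0.re : ℝ)| ≤ hgt q0 := by
    have : q0.re.natAbs ≤ hgt q0 := le_max_left _ _
    rw [← Int.cast_abs, Int.abs_eq_natAbs]; exact_mod_cast this
  have H2 : |(q0.im : ℝ)| ≤ hgt q0 := by
    have : q0.im.natAbs ≤ hgt q0 := le_max_right _ _
    rw [← Int.cast_abs, Int.abs_eq_natAbs]; exact_mod_cast this
  have H3 : |(q0.im : ℝ) * s| ≤ k * hgt q0 := by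
    rw [abs_mul, abs_of_nonneg s0, mul_comm]
    exact mul_le_mul s2 H2 (abs_nonneg _) (by positivity)
  have K : ∀ σ : ℝ, |σ| ≤ |(q0.re : ℝ)| + |(q0.im : ℝ) * s| → |σ| ≤ (k + 1) * hgt q0 := by
    intro σ hσ; linarith
  have u1 : |q0.re + q0.im * s| ≤ |(q0.re : ℝ)| + |(q0.im : ℝ) * s| := abs_add_le _ _
  have u2 : |q0.re + (-q0.im) * s| ≤ |(q0.re : ℝ)| + |(q0.im : ℝ) * s| := by
    rw [neg_mul, ← sub_eq_add_neg]; exact abs_sub _ _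
  have v1 := abs_le.1 (K _ (r1.trans u1 |> fun h => by simpa using h))
  have v2 := abs_le.1 (K _ (r2.trans u2 |> fun h => by simpa using h))
  have w1 : |(p0.re : ℝ)| ≤ (k + 1) * hgt q0 := by rw [abs_le]; constructor <;> linarith
  have w2' : |(p0.im : ℝ) * s| ≤ (k + 1) * hgt q0 := by rw [abs_le]; constructor <;> linarith
  have w2 : |(p0.im : ℝ)| ≤ (k + 1) * hgt q0 := by
    rw [abs_mul, abs_of_nonneg s0] at w2'
    nlinarith [abs_nonneg (p0.im : ℝ)]
  rw [← Int.cast_abs, Int.abs_eq_natAbs] at w1 w2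
  exact max_le (by exact_mod_cast w1) (by exact_mod_cast w2)

/-- directions -/
noncomputable def dirs (k m : ℕ) : Finset ((ℤ√(k : ℤ)) × (ℤ√(k : ℤ))) := box k (3 * k * m) 0 m ×ˢ box k 0 0 m

open Classical in
lemma bad_count {k : ℕ} [Zsqrtd.Nonsquare k] (hk : 0 < k) (w : ℕ) (hw : 0 < w) :
    2 * ((dirs k (6 * (2 * k + 3) * w)).filter (fun g => ¬ Good g w)).card ≤
      (6 * (2 * k + 3) * w) ^ 4 := by
  set m := 6 * (2 * k + 3) * w with hm
  have hwm : w ≤ m := by rw [hm]; nlinarith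
  let fib : (ℤ√(k : ℤ)) → (ℤ√(k : ℤ)) → Finset ((ℤ√(k : ℤ)) × (ℤ√(k : ℤ))) := fun q0 p0 =>
    if Good (q0, p0) (hgt q0) then (dirs k m).filter (fun g => q0 * g.2 = p0 * g.1) else ∅
  let Q0 := (box (k : ℤ) (-w) (-w) (2 * w)).filter (fun q => q ≠ 0 ∧ hgt q < w)
  have hsub : (dirs k m).filter (fun g => ¬ Good g w) ⊆
      Q0.biUnion fun q0 => (ball k ((k + 1) * hgt q0)).biUnion fun p0 => fib q0 p0 := by
    intro g hg
    rw [Finset.mem_filter] at hg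
    obtain ⟨hgV, hgb⟩ := hg
    have hgV' := hgV
    rw [dirs, Finset.mem_product] at hgV'
    have hex : ∃ h : ℕ, ∃ q' p' : ℤ√(k : ℤ), q' ≠ 0 ∧ g.1 * p' = g.2 * q' ∧ hgt q' = h := by
      unfold Good at hgb; push Not at hgb
      obtain ⟨q', p', a, b, -⟩ := hgb
      exact ⟨_, q', p', a, b, rfl⟩
    obtain ⟨q0, p0, hq0, heq, hh⟩ := Nat.find_spec hex
    have hmin : ∀ q' p' : ℤ√(k : ℤ), q' ≠ 0 → g.1 * p' = g.2 * q' → hgt q0 ≤ hgt q' := by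
      intro q' p' a b
      rw [hh]; exact Nat.find_min' hex ⟨q', p', a, b, rfl⟩
    have hlt : hgt q0 < w := by
      unfold Good at hgb; push Not at hgb
      obtain ⟨q', p', a, b, c⟩ := hgb
      exact (hmin q' p' a b).trans_lt c
    have heq' : q0 * g.2 = p0 * g.1 := by rw [mul_comm, ← heq, mul_comm]
    have hgood : Good (q0, p0) (hgt q0) := by
      intro q' p' a b
      apply hmin q' p' a
      apply mul_left_cancel₀ hq0
      simp only at b
      calc q0 * (g.1 * p') = g.1 * (q0 * p') := by ring
        _ = (g.1 * p0) * q' := by rw [b]; ring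
        _ = _ := by rw [heq]; ring
    simp only [Finset.mem_biUnion]
    refine ⟨q0, ?_, p0, ?_, ?_⟩
    · simp only [Q0, Finset.mem_filter, mem_box]
      refine ⟨?_, hq0, hlt⟩
      simp only [hgt] at hlt
      push_cast; omega
    · rw [mem_ball]
      exact bal hk m g.1 g.2 q0 p0 hgV'.1 hgV'.2 heq'
    · simp only [fib, if_pos hgood, Finset.mem_filter]
      exact ⟨hgV, heq'⟩
  have hfib : ∀ q0 ∈ Q0, ∀ p0, (fib q0 p0).card ≤ (m / hgt q0 + 1) * (m / hgt q0 + 1) := by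
    intro q0 hq0 p0
    simp only [Q0, Finset.mem_filter] at hq0
    simp only [fib]
    split_ifs with hG
    · refine pig _ (q0, p0) hq0.2.1 _ (hgt_pos hq0.2.1) hG (3 * k * m) 0 m ?_ ?_
      · intro z hz
        rw [Finset.mem_filter, dirs, Finset.mem_product] at hz
        exact hz.1.1
      · intro z hz z' hz'
        rw [Finset.mem_filter] at hz hz'
        simp only [mul_sub, hz.2, hz'.2]
    · simp
  have hin : ∀ q0 ∈ Q0, ((ball k ((k + 1) * hgt q0)).biUnion fun p0 => fib q0 p0).card ≤
      4 * (2 * k + 3) ^ 2 * m ^ 2 := by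
    intro q0 hq0
    refine (Finset.card_biUnion_le_card_mul _ _ _ (fun p0 _ => hfib q0 hq0 p0)).trans ?_
    simp only [Q0, Finset.mem_filter] at hq0
    have hp := hgt_pos hq0.2.1
    have hl := hq0.2.2
    rw [card_ball]
    generalize hgt q0 = h at *
    have h1 : (2 * ((k + 1) * h) + 1) ≤ (2 * k + 3) * h := by nlinarith
    have h2 : (m / h + 1) * h ≤ 2 * m := by
      have := Nat.div_mul_le_self m h
      nlinarith
    calc _ ≤ ((2 * k + 3) * h * ((2 * k + 3) * h)) * ((m / h + 1) * (m / h + 1)) := by gcongr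
      _ = (2 * k + 3) ^ 2 * (((m / h + 1) * h) * ((m / h + 1) * h)) := by ring
      _ ≤ (2 * k + 3) ^ 2 * ((2 * m) * (2 * m)) := by gcongr
      _ = _ := by ring
  have h1 := (Finset.card_le_card hsub).trans (Finset.card_biUnion_le_card_mul _ _ _ hin)
  have h2 : Q0.card ≤ 2 * w * (2 * w) := (Finset.card_filter_le _ _).trans (card_box _ _ _ _).le
  calc _ ≤ 2 * ((2 * w * (2 * w)) * (4 * (2 * k + 3) ^ 2 * m ^ 2)) := by
        gcongr; exact h1.trans (by gcongr)
    _ = (32 * (2 * k + 3) ^ 2 * w ^ 2) * m ^ 2 := by ring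
    _ ≤ (36 * (2 * k + 3) ^ 2 * w ^ 2) * m ^ 2 := by gcongr; norm_num
    _ = m ^ 2 * m ^ 2 := by rw [hm]; ring
    _ = m ^ 4 := by ring

lemma aSet_eq (k N : ℕ) : aSet k N = emb k '' (ball (k : ℤ) (Nat.sqrt N) : Set (ℤ√(k : ℤ))) := by
  have key : ∀ x : ℤ, |(x : ℝ)| ≤ Real.sqrt N ↔ x.natAbs ≤ Nat.sqrt N := by
    intro x
    rw [← Int.cast_abs, Int.abs_eq_natAbs, Int.cast_natCast, Nat.le_sqrt,
      Real.le_sqrt (Nat.cast_nonneg _), sq]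
    · exact_mod_cast Iff.rfl
    · exact Nat.cast_nonneg _
  ext x
  simp only [aSet, Set.mem_ofPred_eq, Set.mem_image, Finset.mem_coe, mem_ball, hgt, max_le_iff, key,
    emb_apply]
  constructor
  · rintro ⟨a, b, ha, hb, rfl⟩
    exact ⟨⟨a, b⟩, ⟨ha, hb⟩, rfl⟩
  · rintro ⟨z, h, rfl⟩
    exact ⟨z.re, z.im, h.1, h.2, rfl⟩

lemma mem_aSet {k N : ℕ} {x : ℤ√(k : ℤ)} (h : hgt x ≤ Nat.sqrt N) : emb k x ∈ aSet k N := by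
  rw [aSet_eq]; exact ⟨x, by simpa [mem_ball] using h, rfl⟩

lemma finite_aSet (k N : ℕ) : (aSet k N).Finite := by
  rw [aSet_eq]; exact (Finset.finite_toSet _).image _

lemma ncard_aSet_le (k N : ℕ) :
    (aSet k N).ncard ≤ (2 * Nat.sqrt N + 1) * (2 * Nat.sqrt N + 1) := by
  rw [aSet_eq, ← card_ball (k : ℤ), ← Set.ncard_coe_finset]
  exact Set.ncard_image_le (Finset.finite_toSet _)

/-- The line through `z` with direction `g`. -/
def ln (k : ℕ) (g z : (ℤ√(k : ℤ)) × (ℤ√(k : ℤ))) : Set (ℝ × ℝ) :=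
  {P | (-emb k g.2) * P.1 + emb k g.1 * P.2 = emb k (g.1 * z.2 - g.2 * z.1)}

lemma mem_ln {k : ℕ} [Zsqrtd.Nonsquare k] (g z x : (ℤ√(k : ℤ)) × (ℤ√(k : ℤ))) :
    (emb k x.1, emb k x.2) ∈ ln k g z ↔ g.1 * (x.2 - z.2) = g.2 * (x.1 - z.1) := by
  simp only [ln, Set.mem_ofPred_eq]
  rw [← (emb_inj k).eq_iff (a := g.1 * (x.2 - z.2))]
  simp only [map_mul, map_sub]
  constructor <;> intro h <;> linarith

lemma isLine_ln {k : ℕ} [Zsqrtd.Nonsquare k] (g z : (ℤ√(k : ℤ)) × (ℤ√(k : ℤ))) (hg : g.1 ≠ 0) :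
    IsLine (ln k g z) := by
  refine ⟨-emb k g.2, emb k g.1, _, ?_, rfl⟩
  intro h
  rw [Prod.mk.injEq] at h
  exact hg ((map_eq_zero_iff _ (emb_inj k)).1 h.2)

lemma rich_ln {k N : ℕ} [Zsqrtd.Nonsquare k] (hk : 0 < k)
    (g z : (ℤ√(k : ℤ)) × (ℤ√(k : ℤ))) (hg : g.1 ≠ 0) (T M u : ℕ)
    (h1 : hgt g.1 ≤ M) (h2 : hgt g.2 ≤ M) (h3 : hgt z.1 ≤ u) (h4 : hgt z.2 ≤ u)
    (h : u + (k + 1) * (T * M) ≤ Nat.sqrt N) :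
    (2 * T + 1) * (2 * T + 1) ≤ ((aSet k N ×ˢ aSet k N : Set (ℝ × ℝ)) ∩ ln k g z).ncard := by
  rw [← card_ball (k : ℤ), ← Set.ncard_coe_finset]
  refine Set.ncard_le_ncard_of_injOn (fun t => (emb k (z.1 + t * g.1), emb k (z.2 + t * g.2)))
    ?_ ?_ (((finite_aSet k N).prod (finite_aSet k N)).subset Set.inter_subset_left)
  · intro t ht
    rw [Finset.mem_coe, mem_ball] at ht
    have aux : ∀ a b : ℤ√(k : ℤ), hgt a ≤ u → hgt b ≤ M → hgt (a + t * b) ≤ Nat.sqrt N := by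
      intro a b ha hb
      have e1 := hgt_add a (t * b)
      have e2 := hgt_mul hk t b
      have e3 : (k + 1) * (hgt t * hgt b) ≤ (k + 1) * (T * M) := by gcongr
      omega
    refine ⟨⟨mem_aSet (aux _ _ h3 h1), mem_aSet (aux _ _ h4 h2)⟩, ?_⟩
    rw [mem_ln g z (z.1 + t * g.1, z.2 + t * g.2)]
    ring
  · intro t _ t' _ e
    simp only [Prod.mk.injEq] at e
    have := emb_inj k e.1
    exact mul_right_cancel₀ hg (add_left_cancel this)

lemma ln_eq {k : ℕ} [Zsqrtd.Nonsquare k] {g z g' z' : (ℤ√(k : ℤ)) × (ℤ√(k : ℤ))}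
    (h : ln k g z = ln k g' z') :
    g.1 * g'.2 = g.2 * g'.1 ∧ g.1 * (z'.2 - z.2) = g.2 * (z'.1 - z.1) := by
  have m1 : (emb k z'.1, emb k z'.2) ∈ ln k g z := by
    rw [h, mem_ln]; ring
  have m2 : (emb k (z'.1 + g'.1), emb k (z'.2 + g'.2)) ∈ ln k g z := by
    rw [h, mem_ln g' z' (z'.1 + g'.1, z'.2 + g'.2)]; ring
  rw [mem_ln] at m1
  rw [mem_ln g z (z'.1 + g'.1, z'.2 + g'.2)] at m2
  refine ⟨?_, m1⟩
  linear_combination m2 - m1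

open Classical in
lemma many_lines {k : ℕ} [Zsqrtd.Nonsquare k] (hk : 0 < k) (N T w : ℕ) (hw : 0 < w)
    (hT : (k + 1) * (T * (4 * k * (6 * (2 * k + 3) * w))) ≤ Nat.sqrt N / 2) :
    ∃ Lr : Finset (Set (ℝ × ℝ)),
      (∀ ℓ ∈ Lr, IsLine ℓ ∧
        (2 * T + 1) * (2 * T + 1) ≤ ((aSet k N ×ˢ aSet k N : Set (ℝ × ℝ)) ∩ ℓ).ncard) ∧
      (6 * (2 * k + 3) * w) ^ 4 * (Nat.sqrt N / 2 + 1) ^ 4 ≤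
        2 * ((6 * (2 * k + 3) + 1) ^ 2 * ((Nat.sqrt N / 2 + 1) / w + 1) ^ 2 * Lr.card) := by
  have hbad := bad_count hk w hw
  set D := 6 * (2 * k + 3) with hD
  set m := D * w with hm
  set n := Nat.sqrt N
  set u := n / 2 + 1 with hu
  have hm0 : 0 < m := by positivity
  let G := (dirs k m).filter (fun g => Good g w)
  let Z := box (k : ℤ) 0 0 u ×ˢ box (k : ℤ) 0 0 u
  have hG : m ^ 4 ≤ 2 * G.card := by
    have := Finset.card_filter_add_card_filter_not (s := dirs k m) (fun g => Good g w)
    have hc : (dirs k m).card = m ^ 4 := by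
      rw [dirs, Finset.card_product, card_box, card_box]; ring
    simp only [G]
    omega
  have hZ : Z.card = u ^ 4 := by
    simp only [Z]; rw [Finset.card_product, card_box]; ring
  have hG1 : ∀ g ∈ G, g.1 ∈ box (k : ℤ) (3 * k * m) 0 m ∧ g.2 ∈ box (k : ℤ) 0 0 m ∧ Good g w := by
    intro g hg
    simp only [G, dirs, Finset.mem_filter, Finset.mem_product] at hg
    exact ⟨hg.1.1, hg.1.2, hg.2⟩
  have hkm : m ≤ k * m := Nat.le_mul_of_pos_left m hk
  have hG0 : ∀ g ∈ G, g.1 ≠ 0 := by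
    intro g hg h0
    have := (mem_box.1 (hG1 g hg).1).1.1
    rw [h0] at this
    have h5 : (0 : ℤ) < 3 * k * m := by positivity
    simp at this
    omega
  refine ⟨(G ×ˢ Z).image (fun gz => ln k gz.1 gz.2), ?_, ?_⟩
  · intro ℓ hℓ
    simp only [Finset.mem_image, Finset.mem_product] at hℓ
    obtain ⟨⟨g, z⟩, ⟨hg, hz⟩, rfl⟩ := hℓ
    refine ⟨isLine_ln g z (hG0 g hg), ?_⟩
    obtain ⟨b1, b2, -⟩ := hG1 g hg
    simp only [Z, Finset.mem_product, mem_box] at hz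
    rw [mem_box] at b1 b2
    have c1 : ((3 * k * m : ℕ) : ℤ) ≤ g.1.re := by push_cast; exact b1.1.1
    have c2 : g.1.re < ((3 * k * m + m : ℕ) : ℤ) := by push_cast; exact b1.1.2
    have c3 : 3 * k * m + m ≤ 4 * k * m := by nlinarith
    have c4 : m ≤ 4 * k * m := by nlinarith
    generalize 3 * k * m = X at *
    refine rich_ln hk g z (hG0 g hg) T (4 * k * m) (n / 2) ?_ ?_ ?_ ?_ (by omega)
    · simp only [hgt]; omega
    · simp only [hgt]; omega
    · simp only [hgt]; omega
    · simp only [hgt]; omega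
  · have hfib : (G ×ˢ Z).card ≤ ((D + 1) * (D + 1) * ((u / w + 1) * (u / w + 1))) *
        ((G ×ˢ Z).image (fun gz => ln k gz.1 gz.2)).card := by
      apply Finset.card_le_mul_card_image
      intro ℓ hℓ
      simp only [Finset.mem_image, Finset.mem_product] at hℓ
      obtain ⟨⟨g, z⟩, ⟨hg, hz⟩, rfl⟩ := hℓ
      simp only at hg hz
      have hsub : {a ∈ G ×ˢ Z | ln k a.1 a.2 = ln k g z} ⊆
          (G.filter (fun g' => g.1 * g'.2 = g.2 * g'.1)) ×ˢ
          (Z.filter (fun z' => g.1 * (z'.2 - z.2) = g.2 * (z'.1 - z.1))) := by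
        rintro ⟨g', z'⟩ h
        simp only [Finset.mem_filter, Finset.mem_product] at h ⊢
        have := ln_eq h.2.symm
        exact ⟨⟨h.1.1, this.1⟩, h.1.2, this.2⟩
      refine (Finset.card_le_card hsub).trans ?_
      rw [Finset.card_product]
      have hmw : m / w = D := Nat.mul_div_cancel _ hw
      apply Nat.mul_le_mul
      · rw [← hmw]
        refine pig _ g (hG0 g hg) w hw (hG1 g hg).2.2 (3 * k * m) 0 m ?_ ?_
        · intro x hx; exact (hG1 x (Finset.mem_filter.1 hx).1).1
        · intro x hx y hy
          linear_combination (Finset.mem_filter.1 hx).2 - (Finset.mem_filter.1 hy).2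
      · refine pig _ g (hG0 g hg) w hw (hG1 g hg).2.2 0 0 u ?_ ?_
        · intro x hx; exact (Finset.mem_product.1 (Finset.mem_filter.1 hx).1).1
        · intro x hx y hy
          linear_combination (Finset.mem_filter.1 hx).2 - (Finset.mem_filter.1 hy).2
    rw [Finset.card_product, hZ] at hfib
    calc m ^ 4 * u ^ 4 ≤ 2 * G.card * u ^ 4 := by gcongr
      _ = 2 * (G.card * u ^ 4) := by ring
      _ ≤ 2 * (((D + 1) * (D + 1) * ((u / w + 1) * (u / w + 1))) *
        ((G ×ˢ Z).image (fun gz => ln k gz.1 gz.2)).card) := Nat.mul_le_mul_left _ hfib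
      _ = _ := by ring

open Classical in
lemma horiz {k : ℕ} [Zsqrtd.Nonsquare k] (hk : 0 < k) (N : ℕ) :
    ∃ Lr : Finset (Set (ℝ × ℝ)),
      (∀ ℓ ∈ Lr, IsLine ℓ ∧
        N ≤ ((aSet k N ×ˢ aSet k N : Set (ℝ × ℝ)) ∩ ℓ).ncard) ∧
      (Nat.sqrt N) ^ 2 ≤ Lr.card := by
  set n := Nat.sqrt N with hn
  refine ⟨(ball (k : ℤ) n).image (fun y => {P : ℝ × ℝ | 0 * P.1 + 1 * P.2 = emb k y}), ?_, ?_⟩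
  · intro ℓ hℓ
    simp only [Finset.mem_image] at hℓ
    obtain ⟨y, hy, rfl⟩ := hℓ
    refine ⟨⟨0, 1, emb k y, by simp, rfl⟩, ?_⟩
    have h1 : N ≤ (2 * n + 1) * (2 * n + 1) := by
      have := Nat.lt_succ_sqrt N
      simp only [Nat.succ_eq_add_one] at this
      nlinarith
    refine h1.trans ?_
    rw [← card_ball (k : ℤ), ← Set.ncard_coe_finset]
    refine Set.ncard_le_ncard_of_injOn (fun t => (emb k t, emb k y)) ?_ ?_
      (((finite_aSet k N).prod (finite_aSet k N)).subset Set.inter_subset_left)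
    · intro t ht
      rw [Finset.mem_coe, mem_ball] at ht
      rw [mem_ball] at hy
      exact ⟨⟨mem_aSet ht, mem_aSet hy⟩, by simp⟩
    · intro t _ t' _ e
      simp only [Prod.mk.injEq] at e
      exact emb_inj k e.1
  · rw [Finset.card_image_of_injective, card_ball]
    · nlinarith
    · intro y y' h
      have : ((0 : ℝ), emb k y) ∈ {P : ℝ × ℝ | 0 * P.1 + 1 * P.2 = emb k y'} := by
        simp only at h
        rw [← h]; simp
      apply emb_inj k
      simpa using this

lemma combined {k : ℕ} [Zsqrtd.Nonsquare k] (hk : 0 < k) :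
    ∃ C : ℕ, 0 < C ∧ ∀ N r : ℕ, 2 ≤ r → r ≤ N →
    ∃ Lr : Finset (Set (ℝ × ℝ)),
      (∀ ℓ ∈ Lr, IsLine ℓ ∧
        r ≤ ((aSet k N ×ˢ aSet k N : Set (ℝ × ℝ)) ∩ ℓ).ncard) ∧
      (Nat.sqrt N) ^ 8 ≤ C * r ^ 3 * Lr.card := by
  set D := 6 * (2 * k + 3) with hD
  set B := 8 * k * (k + 1) * D with hB
  have hD0 : 0 < D := by positivity
  have hB0 : 0 < B := by positivity
  refine ⟨(2 * B) ^ 6 * 128 * (D + 1) ^ 2, by positivity, ?_⟩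
  intro N r hr hrN
  set n := Nat.sqrt N with hn
  set T := Nat.sqrt r with hT
  have hTr : T ^ 2 ≤ r := Nat.sqrt_le' r
  have hT6 : T ^ 6 ≤ r ^ 3 := by
    calc T ^ 6 = (T ^ 2) ^ 3 := by ring
      _ ≤ _ := by gcongr
  have hT0 : 0 < T := Nat.sqrt_pos.2 (by omega)
  have hBT : 0 < B * T := by positivity
  by_cases hw : n / (B * T) = 0
  · obtain ⟨L, h1, h2⟩ := horiz hk N
    refine ⟨L, fun ℓ hℓ => ⟨(h1 ℓ hℓ).1, hrN.trans (h1 ℓ hℓ).2⟩, ?_⟩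
    have h3 : n ≤ B * T := by
      rcases Nat.div_eq_zero_iff.1 hw with h | h <;> omega
    have h5 : B ^ 6 ≤ (2 * B) ^ 6 * 128 * (D + 1) ^ 2 := by
      have h7 : B ^ 6 ≤ (2 * B) ^ 6 := by gcongr; omega
      have h8 : 0 < 128 * (D + 1) ^ 2 := by positivity
      rw [mul_assoc]
      exact h7.trans (Nat.le_mul_of_pos_right _ h8)
    calc n ^ 8 = n ^ 6 * n ^ 2 := by ring
      _ ≤ (B * T) ^ 6 * L.card := by gcongr
      _ = B ^ 6 * T ^ 6 * L.card := by ring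
      _ ≤ _ := by gcongr
  · set w := n / (B * T) with hwdef
    have hw0 : 0 < w := Nat.pos_of_ne_zero hw
    have e1 : w * (B * T) ≤ n := Nat.div_mul_le_self _ _
    have e2 : n ≤ 2 * B * T * w := by
      have := Nat.lt_div_mul_add (a := n) hBT
      rw [← hwdef] at this
      nlinarith
    have e3 : (k + 1) * (T * (4 * k * (D * w))) ≤ n / 2 := by
      rw [Nat.le_div_iff_mul_le (by norm_num)]
      calc _ = w * (B * T) := by rw [hB]; ring
        _ ≤ n := e1
    obtain ⟨L, h1, h2⟩ := many_lines hk N T w hw0 e3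
    refine ⟨L, fun ℓ hℓ => ⟨(h1 ℓ hℓ).1, le_trans ?_ (h1 ℓ hℓ).2⟩, ?_⟩
    · have := Nat.lt_succ_sqrt r
      simp only [Nat.succ_eq_add_one, ← hT] at this
      nlinarith
    · rw [← hD, ← hn] at h2
      set u := n / 2 + 1 with hu
      have hwn : w ≤ n := Nat.div_le_self _ _
      have hn0 : 0 < n := by omega
      have u1 : n ≤ 2 * u := by omega
      have u2 : u ≤ n := by
        have : 2 ≤ n := by
          have : 1 * (2 * 1) ≤ w * (B * T) := by
            gcongr
            · exact hw0
            · rw [hB]; nlinarith [Nat.mul_pos (Nat.mul_pos hk (Nat.succ_pos k)) hD0]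
            · exact hT0
          omega
        omega
      have u3 : (u / w + 1) * w ≤ 2 * n := by
        have := Nat.div_mul_le_self u w
        nlinarith
      have f1 : D ^ 4 * w ^ 6 * n ^ 4 ≤ 128 * (D + 1) ^ 2 * n ^ 2 * L.card := by
        calc D ^ 4 * w ^ 6 * n ^ 4 ≤ D ^ 4 * w ^ 6 * (2 * u) ^ 4 := by gcongr
          _ = 16 * w ^ 2 * ((D * w) ^ 4 * u ^ 4) := by ring
          _ ≤ 16 * w ^ 2 * (2 * ((D + 1) ^ 2 * (u / w + 1) ^ 2 * L.card)) := by gcongr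
          _ = 32 * (D + 1) ^ 2 * ((u / w + 1) * w) ^ 2 * L.card := by ring
          _ ≤ 32 * (D + 1) ^ 2 * (2 * n) ^ 2 * L.card := by gcongr
          _ = _ := by ring
      have f2 : w ^ 6 * n ^ 4 ≤ 128 * (D + 1) ^ 2 * n ^ 2 * L.card := by
        refine le_trans ?_ f1
        rw [mul_assoc]
        exact Nat.le_mul_of_pos_left _ (by positivity)
      have f3 : n ^ 8 * n ^ 2 ≤ ((2 * B) ^ 6 * 128 * (D + 1) ^ 2 * r ^ 3 * L.card) * n ^ 2 := by
        calc n ^ 8 * n ^ 2 = n ^ 6 * n ^ 4 := by ring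
          _ ≤ (2 * B * T * w) ^ 6 * n ^ 4 := by gcongr
          _ = (2 * B) ^ 6 * T ^ 6 * (w ^ 6 * n ^ 4) := by ring
          _ ≤ (2 * B) ^ 6 * r ^ 3 * (128 * (D + 1) ^ 2 * n ^ 2 * L.card) := by gcongr
          _ = _ := by ring
      exact Nat.le_of_mul_le_mul_right f3 (by positivity)

/-- Main construction: sharp Szemerédi–Trotter examples on `P = A_N × A_N`. -/
theorem main_construction (k : ℕ) (hk : 0 < k) (hks : ¬ IsSquare k) :
    ∃ c₀ : ℝ, 0 < c₀ ∧ ∃ N₀ : ℕ, ∀ N : ℕ, N₀ ≤ N → ∀ r : ℕ, 2 ≤ r → r ≤ N →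
      ∃ Lr : Finset (Set (ℝ × ℝ)),
        (∀ ℓ ∈ Lr, IsLine ℓ ∧
          r ≤ ((aSet k N ×ˢ aSet k N : Set (ℝ × ℝ)) ∩ ℓ).ncard) ∧
        c₀ * (((aSet k N ×ˢ aSet k N : Set (ℝ × ℝ)).ncard : ℝ) ^ 2 / (r : ℝ) ^ 3 +
            ((aSet k N ×ˢ aSet k N : Set (ℝ × ℝ)).ncard : ℝ) / (r : ℝ)) ≤
          (Lr.card : ℝ) := by
  have : Zsqrtd.Nonsquare k := ⟨fun n hn => hks ⟨n, hn⟩⟩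
  obtain ⟨C, hC, H⟩ := combined hk
  refine ⟨1 / (7857 * C), by positivity, 1, ?_⟩
  intro N hN r hr hrN
  obtain ⟨L, h1, h2⟩ := H N r hr hrN
  refine ⟨L, h1, ?_⟩
  have hn0 : 1 ≤ Nat.sqrt N := Nat.sqrt_pos.2 hN
  have hp : (aSet k N ×ˢ aSet k N : Set (ℝ × ℝ)).ncard ≤ 81 * (Nat.sqrt N) ^ 4 := by
    rw [Set.ncard_prod]
    have := ncard_aSet_le k N
    have h3 : (2 * Nat.sqrt N + 1) * (2 * Nat.sqrt N + 1) ≤ 9 * (Nat.sqrt N) ^ 2 := by nlinarith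
    calc _ ≤ (9 * (Nat.sqrt N) ^ 2) * (9 * (Nat.sqrt N) ^ 2) :=
          Nat.mul_le_mul (this.trans h3) (this.trans h3)
      _ = _ := by ring
  have hr4 : r ≤ 4 * (Nat.sqrt N) ^ 2 := by
    have := Nat.lt_succ_sqrt N
    simp only [Nat.succ_eq_add_one] at this
    nlinarith
  generalize (aSet k N ×ˢ aSet k N : Set (ℝ × ℝ)).ncard = p at *
  generalize Nat.sqrt N = n at *
  have hr0 : (0 : ℝ) < r := by exact_mod_cast (by omega : 0 < r)
  have hC0 : (0 : ℝ) < C := by exact_mod_cast hC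
  have hp' : (p : ℝ) ≤ 81 * (n : ℝ) ^ 4 := by exact_mod_cast hp
  have hr4' : (r : ℝ) ≤ 4 * (n : ℝ) ^ 2 := by exact_mod_cast hr4
  have h2' : (n : ℝ) ^ 8 ≤ C * (r : ℝ) ^ 3 * L.card := by exact_mod_cast h2
  have e : (p : ℝ) ^ 2 / (r : ℝ) ^ 3 + (p : ℝ) / r = ((p : ℝ) ^ 2 + p * (r : ℝ) ^ 2) / (r : ℝ) ^ 3 := by
    field_simp
  have e2 : (p : ℝ) ^ 2 + p * (r : ℝ) ^ 2 ≤ 7857 * (n : ℝ) ^ 8 := by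
    calc (p : ℝ) ^ 2 + p * (r : ℝ) ^ 2
        ≤ (81 * (n : ℝ) ^ 4) ^ 2 + (81 * (n : ℝ) ^ 4) * (4 * (n : ℝ) ^ 2) ^ 2 := by gcongr
      _ = _ := by ring
  rw [e, div_mul_div_comm, div_le_iff₀ (by positivity)]
  nlinarith
end

section
/- (Size of the slope set) For every positive integer k that is not a perfect square there exists c* ∈ (0,1) such that for every constant c ∈ (c*,1) there exist constants c₁, C₁ > 0 and M₀ such that for all M ≥ M₀, the slope set S satisfies c₁·M² ≤ |S| ≤ C₁·M². -/
/-- The slope set `S` with parameters `M` and `c`. -/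
def slopeSet (k : ℕ) (M c : ℝ) : Set ℝ :=
  {s : ℝ | ∃ p₁ p₂ q₁ q₂ : ℤ,
    (c * Real.sqrt M ≤ |(p₁ : ℝ)| ∧ |(p₁ : ℝ)| ≤ Real.sqrt M) ∧
    (c * Real.sqrt M ≤ |(p₂ : ℝ)| ∧ |(p₂ : ℝ)| ≤ Real.sqrt M) ∧
    (c * Real.sqrt M ≤ |(q₁ : ℝ)| ∧ |(q₁ : ℝ)| ≤ Real.sqrt M) ∧
    (c * Real.sqrt M ≤ |(q₂ : ℝ)| ∧ |(q₂ : ℝ)| ≤ Real.sqrt M) ∧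
    (¬ ∃ d : ℕ, d.Prime ∧ 5 < d ∧
      (d : ℤ) ∣ (p₁ ^ 2 - (k : ℤ) * p₂ ^ 2) ∧ (d : ℤ) ∣ (q₁ ^ 2 - (k : ℤ) * q₂ ^ 2)) ∧
    (¬ ∃ d : ℕ, d.Prime ∧ 5 < d ∧ (d : ℤ) ∣ p₁ ∧ (d : ℤ) ∣ p₂) ∧
    s = ((p₁ : ℝ) + (p₂ : ℝ) * Real.sqrt k) / ((q₁ : ℝ) + (q₂ : ℝ) * Real.sqrt k)}

open Finset in
/-- Counting pairs sharing a large prime. -/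
lemma bad_count_s5 {A B : Type*} (a : Finset A) (b : Finset B) (f : A → ℤ) (g : B → ℤ)
    (n L P : ℕ) (hP : 0 < P) (hL : 0 < L) (ha : a.card = n)
    (hf : ∀ x ∈ a, f x ≠ 0 ∧ (f x).natAbs < L ^ 3)
    (hcf : ∀ d : ℕ, d.Prime → (a.filter (fun x => (d : ℤ) ∣ f x)).card * min d L ≤ 4 * n)
    (hcg : ∀ d : ℕ, d.Prime → (b.filter (fun x => (d : ℤ) ∣ g x)).card * min d L ≤ 4 * n)
    (S : Finset (A × B)) (hS : S ⊆ a ×ˢ b)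
    (hSd : ∀ z ∈ S, ∃ d : ℕ, d.Prime ∧ P < d ∧ (d : ℤ) ∣ f z.1 ∧ (d : ℤ) ∣ g z.2) :
    (S.card : ℝ) ≤ 16 * n ^ 2 / P + 8 * n ^ 2 / L := by
  classical
  set S1 : Finset (A × B) := ((Ioc P L).filter Nat.Prime).biUnion (fun d =>
    (a.filter (fun x => (d : ℤ) ∣ f x)) ×ˢ (b.filter (fun x => (d : ℤ) ∣ g x))) with hS1
  set S2 : Finset (A × B) := a.biUnion (fun x =>
    ((f x).natAbs.primeFactors.filter (fun d => L < d)).biUnion (fun d =>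
      ({x} : Finset A) ×ˢ (b.filter (fun y => (d : ℤ) ∣ g y)))) with hS2
  have hsub : S ⊆ S1 ∪ S2 := by
    intro z hz
    obtain ⟨d, hd, hPd, h1, h2⟩ := hSd z hz
    have hz' := mem_product.1 (hS hz)
    rw [mem_union]
    by_cases hdL : d ≤ L
    · left
      rw [hS1, mem_biUnion]
      refine ⟨d, ?_, ?_⟩
      · simp [hd, hPd, hdL]
      · simp only [mem_product, mem_filter]
        exact ⟨⟨hz'.1, h1⟩, hz'.2, h2⟩
    · right
      rw [hS2, mem_biUnion]
      refine ⟨z.1, hz'.1, ?_⟩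
      rw [mem_biUnion]
      refine ⟨d, ?_, ?_⟩
      · simp only [mem_filter, Nat.mem_primeFactors]
        refine ⟨⟨hd, Int.natCast_dvd.1 h1, by simpa using (hf _ hz'.1).1⟩, by omega⟩
      · simp only [mem_product, mem_filter, mem_singleton]
        exact ⟨trivial, hz'.2, h2⟩
  have hc1 : (S1.card : ℝ) ≤ 16 * n ^ 2 / P := by
    have h1 : (S1.card : ℝ) ≤ ∑ d ∈ (Ioc P L).filter Nat.Prime,
        (16 * (n : ℝ) ^ 2) * ((d : ℝ) ^ 2)⁻¹ := by
      refine le_trans (Nat.cast_le.2 card_biUnion_le) ?_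
      rw [Nat.cast_sum]
      refine sum_le_sum ?_
      intro d hd
      simp only [mem_filter, mem_Ioc] at hd
      have e1 := hcf d hd.2
      have e2 := hcg d hd.2
      rw [min_eq_left hd.1.2] at e1 e2
      have e3 := Nat.mul_le_mul e1 e2
      have hd0 : (0 : ℝ) < d := by exact_mod_cast hd.2.pos
      rw [card_product, ← div_eq_mul_inv, le_div_iff₀ (by positivity)]
      have e4 : (((a.filter (fun x => (d : ℤ) ∣ f x)).card * d *
        ((b.filter (fun x => (d : ℤ) ∣ g x)).card * d) : ℕ) : ℝ) ≤ ((4 * n * (4 * n) : ℕ) : ℝ) :=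
        Nat.cast_le.2 e3
      push_cast at e4 ⊢
      nlinarith [e4]
    have h2 : ∑ d ∈ (Ioc P L).filter Nat.Prime, (16 * (n : ℝ) ^ 2) * ((d : ℝ) ^ 2)⁻¹ ≤
        ∑ d ∈ (Ioc P L), (16 * (n : ℝ) ^ 2) * ((d : ℝ) ^ 2)⁻¹ :=
      sum_le_sum_of_subset_of_nonneg (filter_subset _ _) (fun _ _ _ => by positivity)
    refine h1.trans (h2.trans ?_)
    rw [← mul_sum, div_eq_mul_inv]
    refine mul_le_mul_of_nonneg_left ?_ (by positivity)
    by_cases hPL : P ≤ L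
    · have := sum_Ioc_inv_sq_le_sub (α := ℝ) hP.ne' hPL
      have h3 : (0 : ℝ) ≤ (L : ℝ)⁻¹ := by positivity
      linarith
    · rw [Ioc_eq_empty (by omega)]
      simp
  have hc2 : (S2.card : ℝ) ≤ 8 * n ^ 2 / L := by
    have hL0 : (0 : ℝ) < L := by exact_mod_cast hL
    have key : ∀ x ∈ a, ((((f x).natAbs.primeFactors.filter (fun d => L < d)).biUnion (fun d =>
      ({x} : Finset A) ×ˢ (b.filter (fun y => (d : ℤ) ∣ g y)))).card : ℝ) ≤ 8 * n / L := by
      intro x hx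
      have hcard : ((f x).natAbs.primeFactors.filter (fun d => L < d)).card ≤ 2 := by
        by_contra hcon
        push Not at hcon
        have hne : (f x).natAbs ≠ 0 := by simpa using (hf x hx).1
        have hdvd : (∏ p ∈ (f x).natAbs.primeFactors.filter (fun d => L < d), p) ∣ (f x).natAbs :=
          (prod_dvd_prod_of_subset _ _ _ (filter_subset _ _)).trans (Nat.prod_primeFactors_dvd _)
        have hle := Nat.le_of_dvd (Nat.pos_of_ne_zero hne) hdvd
        have hge : L ^ ((f x).natAbs.primeFactors.filter (fun d => L < d)).card ≤
            (∏ p ∈ (f x).natAbs.primeFactors.filter (fun d => L < d), p) := by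
          apply Finset.pow_card_le_prod
          intro p hp
          exact (mem_filter.1 hp).2.le
        have h3 : L ^ 3 ≤ L ^ ((f x).natAbs.primeFactors.filter (fun d => L < d)).card :=
          Nat.pow_le_pow_right hL hcon
        have := (hf x hx).2
        omega
      refine le_trans (Nat.cast_le.2 card_biUnion_le) ?_
      rw [Nat.cast_sum]
      have h1 : ∀ d ∈ (f x).natAbs.primeFactors.filter (fun d => L < d),
          (((({x} : Finset A) ×ˢ (b.filter (fun y => (d : ℤ) ∣ g y))).card : ℕ) : ℝ) ≤ 4 * n / L := by
        intro d hd
        simp only [mem_filter, Nat.mem_primeFactors] at hd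
        have e2 := hcg d hd.1.1
        rw [min_eq_right hd.2.le] at e2
        rw [card_product, card_singleton, one_mul, le_div_iff₀ hL0]
        exact_mod_cast e2
      refine (sum_le_card_nsmul _ _ _ h1).trans ?_
      rw [nsmul_eq_mul]
      have : (((f x).natAbs.primeFactors.filter (fun d => L < d)).card : ℝ) ≤ 2 := by
        exact_mod_cast hcard
      calc _ ≤ 2 * (4 * (n : ℝ) / L) := mul_le_mul_of_nonneg_right this (by positivity)
        _ = _ := by ring
    refine le_trans (Nat.cast_le.2 card_biUnion_le) ?_
    rw [Nat.cast_sum]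
    refine (sum_le_card_nsmul _ _ _ key).trans ?_
    rw [nsmul_eq_mul, ha]
    apply le_of_eq
    ring
  calc (S.card : ℝ) ≤ ((S1 ∪ S2).card : ℝ) := by exact_mod_cast card_le_card hsub
    _ ≤ S1.card + S2.card := by exact_mod_cast card_union_le _ _
    _ ≤ _ := by linarith

open Finset in
lemma class_count (x0 : ℤ) (L d : ℕ) (hd : 0 < d) (v : ℤ) :
    ((Ico x0 (x0 + L)).filter (fun x => (d : ℤ) ∣ x - v)).card ≤ L / d + 1 := by
  have h1 : (Ico x0 (x0 + L)).filter (fun x => (d : ℤ) ∣ x - v) =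
      (Ico x0 (x0 + L)).filter (fun x => x ≡ v [ZMOD d]) := by
    ext x
    simp only [mem_filter, Int.modEq_iff_dvd, dvd_sub_comm]
  have h2 := Int.Ico_filter_modEq_card x0 (x0 + L) (r := (d : ℤ)) (by exact_mod_cast hd) v
  rw [h1]
  have hd0 : (0 : ℚ) < d := by exact_mod_cast hd
  have h3 : ⌈((x0 + L - v : ℤ) : ℚ) / (d : ℤ)⌉ ≤ ⌈((x0 - v : ℤ) : ℚ) / (d : ℤ)⌉ + (L / d + 1 : ℕ) := by
    generalize hw : (L / d + 1 : ℕ) = w at *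
    rw [Int.ceil_le]
    have h4 := Int.le_ceil (((x0 - v : ℤ) : ℚ) / (d : ℤ))
    have h5 : (L : ℚ) / d ≤ (w : ℕ) := by
      rw [← hw]
      rw [div_le_iff₀ hd0]
      have := Nat.div_add_mod L d
      have h8 := Nat.mod_lt L hd
      have h9 : L ≤ (L / d + 1) * d := by nlinarith
      exact_mod_cast h9
    push_cast at *
    have h6 : ((x0 : ℚ) + L - v) / d = (x0 - v) / d + L / d := by ring
    rw [h6]
    linarith
  have h7 : (((Ico x0 (x0 + L)).filter (fun x => x ≡ v [ZMOD d])).card : ℤ) ≤ (L / d + 1 : ℕ) := by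
    rw [h2]
    apply max_le _ (by positivity)
    push_cast at h3 ⊢
    linarith
  exact_mod_cast h7

lemma min_bound (L d : ℕ) (hd : 0 < d) : (L / d + 1) * min d L ≤ 2 * L := by
  rcases le_total d L with h | h
  · rw [min_eq_left h]
    have := Nat.div_mul_le_self L d
    nlinarith
  · rw [min_eq_right h]
    have : L / d ≤ 1 := by
      calc L / d ≤ d / d := Nat.div_le_div_right h
        _ = 1 := Nat.div_self hd
    nlinarith

open Finset in
lemma norm_line_count (k m : ℤ) (x0 : ℤ) (L d : ℕ) (hd : d.Prime) (y : ℤ) :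
    ((Ico x0 (x0 + L)).filter
      (fun x => (d : ℤ) ∣ (1 + m * x) ^ 2 - k * (m * y) ^ 2)).card ≤ 2 * (L / d + 1) := by
  have hp : Prime (d : ℤ) := Nat.prime_iff_prime_int.1 hd
  by_cases hdm : (d : ℤ) ∣ m
  · rw [filter_false_of_mem]
    · simp
    · intro x _ hx
      have : (d : ℤ) ∣ 1 := by
        have h2 : (1 : ℤ) = ((1 + m * x) ^ 2 - k * (m * y) ^ 2)
          - m * (2 * x + m * x ^ 2 - k * m * y ^ 2) := by ring
        rw [h2]
        exact dvd_sub hx (hdm.mul_right _)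
      exact hp.not_isUnit (isUnit_of_dvd_one this)
  by_cases hne : ∃ u, (d : ℤ) ∣ (1 + m * u) ^ 2 - k * (m * y) ^ 2
  swap
  · rw [filter_false_of_mem]
    · simp
    · intro x _ hx
      exact hne ⟨x, hx⟩
  obtain ⟨u, hu⟩ := hne
  have hv : ∃ v : ℤ, ∀ x : ℤ, (d : ℤ) ∣ 2 + m * x + m * u → (d : ℤ) ∣ x - v := by
    by_cases h : ∃ v : ℤ, (d : ℤ) ∣ 2 + m * v + m * u
    · obtain ⟨v, hv⟩ := h
      refine ⟨v, fun x hx => ?_⟩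
      have : (d : ℤ) ∣ m * (x - v) := by
        have h2 : m * (x - v) = (2 + m * x + m * u) - (2 + m * v + m * u) := by ring
        rw [h2]
        exact dvd_sub hx hv
      exact (hp.dvd_or_dvd this).resolve_left hdm
    · exact ⟨0, fun x hx => (h ⟨x, hx⟩).elim⟩
  obtain ⟨v, hv⟩ := hv
  have hsub : ((Ico x0 (x0 + L)).filter
      (fun x => (d : ℤ) ∣ (1 + m * x) ^ 2 - k * (m * y) ^ 2)) ⊆
      ((Ico x0 (x0 + L)).filter (fun x => (d : ℤ) ∣ x - u)) ∪
      ((Ico x0 (x0 + L)).filter (fun x => (d : ℤ) ∣ x - v)) := by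
    intro x hx
    rw [mem_filter] at hx
    simp only [mem_union, mem_filter, hx.1, true_and]
    have h3 : (d : ℤ) ∣ m * ((x - u) * (2 + m * x + m * u)) := by
      have h2 : m * ((x - u) * (2 + m * x + m * u)) = ((1 + m * x) ^ 2 - k * (m * y) ^ 2)
        - ((1 + m * u) ^ 2 - k * (m * y) ^ 2) := by ring
      rw [h2]
      exact dvd_sub hx.2 hu
    rcases hp.dvd_or_dvd ((hp.dvd_or_dvd h3).resolve_left hdm) with h | h
    · exact Or.inl h
    · exact Or.inr (hv x h)
  have := (card_le_card hsub).trans (card_union_le _ _)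
  have h1 := class_count x0 L d hd.pos u
  have h2 := class_count x0 L d hd.pos v
  omega

open Finset in
lemma norm_count (k m : ℤ) (x0 : ℤ) (L d : ℕ) (hd : d.Prime) :
    ((Ico x0 (x0 + L) ×ˢ Ico x0 (x0 + L)).filter
      (fun z => (d : ℤ) ∣ (1 + m * z.1) ^ 2 - k * (m * z.2) ^ 2)).card * min d L
      ≤ 4 * (L * L) := by
  classical
  have h1 : ((Ico x0 (x0 + L) ×ˢ Ico x0 (x0 + L)).filter
      (fun z => (d : ℤ) ∣ (1 + m * z.1) ^ 2 - k * (m * z.2) ^ 2)).card ≤ L * (2 * (L / d + 1)) := by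
    have hsub : ((Ico x0 (x0 + L) ×ˢ Ico x0 (x0 + L)).filter
      (fun z => (d : ℤ) ∣ (1 + m * z.1) ^ 2 - k * (m * z.2) ^ 2)) ⊆
      (Ico x0 (x0 + L)).biUnion (fun y => ((Ico x0 (x0 + L)).filter
      (fun x => (d : ℤ) ∣ (1 + m * x) ^ 2 - k * (m * y) ^ 2)) ×ˢ {y}) := by
      intro z hz
      simp only [mem_filter, mem_product] at hz
      rw [mem_biUnion]
      refine ⟨z.2, hz.1.2, ?_⟩
      simp only [mem_product, mem_filter, mem_singleton]
      exact ⟨⟨hz.1.1, hz.2⟩, trivial⟩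
    refine (card_le_card hsub).trans (card_biUnion_le.trans ?_)
    refine (sum_le_card_nsmul _ _ (2 * (L / d + 1)) ?_).trans ?_
    · intro y _
      rw [card_product, card_singleton, mul_one]
      exact norm_line_count k m x0 L d hd y
    · simp
  have h2 := min_bound L d hd.pos
  calc _ ≤ L * (2 * (L / d + 1)) * min d L := Nat.mul_le_mul_right _ h1
    _ = 2 * L * ((L / d + 1) * min d L) := by ring
    _ ≤ 2 * L * (2 * L) := Nat.mul_le_mul_left _ h2
    _ = _ := by ring

open Finset in
lemma lin_count (m : ℤ) (x0 : ℤ) (L d : ℕ) (hd : d.Prime) :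
    ((Ico x0 (x0 + L)).filter (fun x => (d : ℤ) ∣ 1 + m * x)).card * min d L ≤ 4 * L := by
  have hp : Prime (d : ℤ) := Nat.prime_iff_prime_int.1 hd
  have h1 : ((Ico x0 (x0 + L)).filter (fun x => (d : ℤ) ∣ 1 + m * x)).card ≤ L / d + 1 := by
    by_cases h : ∃ v : ℤ, (d : ℤ) ∣ 1 + m * v
    · obtain ⟨v, hv⟩ := h
      have hdm : ¬ (d : ℤ) ∣ m := by
        intro hdm
        have : (d : ℤ) ∣ 1 := (dvd_add_left (hdm.mul_right v)).1 hv
        exact hp.not_isUnit (isUnit_of_dvd_one this)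
      refine (card_le_card ?_).trans (class_count x0 L d hd.pos v)
      intro x hx
      rw [mem_filter] at hx ⊢
      refine ⟨hx.1, ?_⟩
      have : (d : ℤ) ∣ m * (x - v) := by
        have h2 : m * (x - v) = (1 + m * x) - (1 + m * v) := by ring
        rw [h2]
        exact dvd_sub hx.2 hv
      exact (hp.dvd_or_dvd this).resolve_left hdm
    · rw [filter_false_of_mem]
      · simp
      · intro x _ hx
        exact h ⟨x, hx⟩
  have h2 := min_bound L d hd.pos
  have := Nat.mul_le_mul_right (min d L) h1
  omega

open Finset in
lemma id_count (x0 : ℤ) (L d : ℕ) (hd : d.Prime) :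
    ((Ico x0 (x0 + L)).filter (fun x => (d : ℤ) ∣ x)).card * min d L ≤ 4 * L := by
  have h1 := class_count x0 L d hd.pos 0
  simp only [sub_zero] at h1
  have h2 := min_bound L d hd.pos
  have := Nat.mul_le_mul_right (min d L) h1
  omega

set_option maxHeartbeats 1000000 in
/-- Injectivity of the slope map on the restricted family. -/
lemma slope_inj (k : ℕ) (hks : ¬ IsSquare k) (hk2 : 2 ≤ k) (m : ℤ) (hm : 2 * (k : ℤ) + 3 < m)
    (N : ℝ) (hN : 0 < N) (c : ℝ) (hc : 9 / 10 < c)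
    (p₁ p₂ q₁ q₂ p₁' p₂' q₁' q₂' : ℤ)
    (h1 : c * N ≤ p₁ ∧ (p₁ : ℝ) ≤ N) (h2 : c * N ≤ p₂ ∧ (p₂ : ℝ) ≤ N)
    (h3 : c * N ≤ q₁ ∧ (q₁ : ℝ) ≤ N) (h4 : c * N ≤ q₂ ∧ (q₂ : ℝ) ≤ N)
    (h1' : c * N ≤ p₁' ∧ (p₁' : ℝ) ≤ N) (h2' : c * N ≤ p₂' ∧ (p₂' : ℝ) ≤ N)
    (h3' : c * N ≤ q₁' ∧ (q₁' : ℝ) ≤ N) (h4' : c * N ≤ q₂' ∧ (q₂' : ℝ) ≤ N)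
    (e1 : m ∣ p₁ - 1) (e2 : m ∣ p₂) (e1' : m ∣ p₁' - 1) (e2' : m ∣ p₂')
    (hcop : IsCoprime (p₁ ^ 2 - (k : ℤ) * p₂ ^ 2) (q₁ ^ 2 - (k : ℤ) * q₂ ^ 2))
    (heq : ((p₁ : ℝ) + (p₂ : ℝ) * Real.sqrt k) / ((q₁ : ℝ) + (q₂ : ℝ) * Real.sqrt k) =
      ((p₁' : ℝ) + (p₂' : ℝ) * Real.sqrt k) / ((q₁' : ℝ) + (q₂' : ℝ) * Real.sqrt k)) :
    p₁ = p₁' ∧ p₂ = p₂' ∧ q₁ = q₁' ∧ q₂ = q₂' := by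
  have hcN : 0 < c * N := by positivity
  have hs : 0 < Real.sqrt k := Real.sqrt_pos.2 (by exact_mod_cast (by omega : 0 < k))
  have hss : Real.sqrt k * Real.sqrt k = k := Real.mul_self_sqrt (by positivity)
  have hirr : Irrational (Real.sqrt k) := by
    rw [irrational_sqrt_natCast_iff]
    exact hks
  have hlin : ∀ a b a' b' : ℤ, (a : ℝ) + b * Real.sqrt k = a' + b' * Real.sqrt k →
      a = a' ∧ b = b' := by
    intro a b a' b' h
    have hb : b = b' := by
      by_contra hne
      have hne' : ((b : ℝ) - b') ≠ 0 := by
        rw [sub_ne_zero]; exact_mod_cast hne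
      apply hirr
      refine ⟨((a' - a : ℤ) : ℚ) / ((b - b' : ℤ) : ℚ), ?_⟩
      push_cast
      rw [div_eq_iff hne']
      linarith
    subst hb
    refine ⟨?_, rfl⟩
    have : (a : ℝ) = a' := by linarith
    exact_mod_cast this
  have hp1 : (0 : ℝ) < p₁ := lt_of_lt_of_le hcN h1.1
  have hp2 : (0 : ℝ) < p₂ := lt_of_lt_of_le hcN h2.1
  have hq1 : (0 : ℝ) < q₁ := lt_of_lt_of_le hcN h3.1
  have hq2 : (0 : ℝ) < q₂ := lt_of_lt_of_le hcN h4.1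
  have hp1' : (0 : ℝ) < p₁' := lt_of_lt_of_le hcN h1'.1
  have hp2' : (0 : ℝ) < p₂' := lt_of_lt_of_le hcN h2'.1
  have hq1' : (0 : ℝ) < q₁' := lt_of_lt_of_le hcN h3'.1
  have hq2' : (0 : ℝ) < q₂' := lt_of_lt_of_le hcN h4'.1
  have hB : (q₁ : ℝ) + (q₂ : ℝ) * Real.sqrt k ≠ 0 := by positivity
  have hB' : (q₁' : ℝ) + (q₂' : ℝ) * Real.sqrt k ≠ 0 := by positivity
  have hA : (p₁ : ℝ) + (p₂ : ℝ) * Real.sqrt k ≠ 0 := by positivity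
  have hcross := (div_eq_div_iff hB hB').1 heq
  obtain ⟨c1, c2⟩ := hlin (p₁ * q₁' + k * (p₂ * q₂')) (p₁ * q₂' + p₂ * q₁')
    (p₁' * q₁ + k * (p₂' * q₂)) (p₁' * q₂ + p₂' * q₁) (by
      push_cast
      linear_combination hcross - (p₂ * q₂' - p₂' * q₂ : ℝ) * hss)
  have hdvd : (⟨p₁, p₂⟩ : ℤ√(k : ℤ)) ∣ ⟨p₁', p₂'⟩ := by
    have hcp : IsCoprime (⟨p₁, p₂⟩ : ℤ√(k : ℤ)) ⟨q₁, q₂⟩ := by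
      obtain ⟨u, v, huv⟩ := hcop
      refine ⟨⟨u * p₁, - (u * p₂)⟩, ⟨v * q₁, - (v * q₂)⟩, ?_⟩
      ext
      · simp only [Zsqrtd.re_add, Zsqrtd.re_mul, Zsqrtd.re_one]
        linear_combination huv
      · simp only [Zsqrtd.im_add, Zsqrtd.im_mul, Zsqrtd.im_one]
        ring
    apply hcp.dvd_of_dvd_mul_right
    refine ⟨⟨q₁', q₂'⟩, ?_⟩
    ext
    · simp only [Zsqrtd.re_mul]
      linear_combination -c1
    · simp only [Zsqrtd.im_mul]
      linear_combination -c2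
  obtain ⟨⟨a, b⟩, hab⟩ := hdvd
  have hr := congrArg Zsqrtd.re hab
  have hi := congrArg Zsqrtd.im hab
  simp only [Zsqrtd.re_mul, Zsqrtd.im_mul] at hr hi
  have hrR : (p₁' : ℝ) = p₁ * a + k * p₂ * b := by exact_mod_cast hr
  have hiR : (p₂' : ℝ) = p₁ * b + p₂ * a := by exact_mod_cast hi
  have hk2R : (2 : ℝ) ≤ k := by exact_mod_cast hk2
  have hD : N ^ 2 / 2 ≤ k * (p₂ : ℝ) ^ 2 - (p₁ : ℝ) ^ 2 := by
    have t1 : (9 / 10 * N) ^ 2 ≤ (p₂ : ℝ) ^ 2 := by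
      apply pow_le_pow_left₀ (by positivity)
      nlinarith [h2.1]
    have t2 : (p₁ : ℝ) ^ 2 ≤ N ^ 2 := pow_le_pow_left₀ hp1.le h1.2 2
    nlinarith [mul_le_mul_of_nonneg_right hk2R (sq_nonneg (p₂ : ℝ))]
  have hbd : ∀ t X : ℝ, t * (k * (p₂ : ℝ) ^ 2 - (p₁ : ℝ) ^ 2) = X → |X| ≤ (1 + k) * N ^ 2 →
      |t| ≤ 2 * (1 + k) := by
    intro t X ht hX
    rw [← ht, abs_mul, abs_of_nonneg (le_trans (by positivity) hD)] at hX
    have : |t| * (N ^ 2 / 2) ≤ (1 + k) * N ^ 2 :=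
      (mul_le_mul_of_nonneg_left hD (abs_nonneg t)).trans hX
    have hN2 : 0 < N ^ 2 := by positivity
    by_contra hcon
    push Not at hcon
    nlinarith
  have pr : ∀ x y : ℝ, 0 < x → x ≤ N → 0 < y → y ≤ N → 0 ≤ x * y ∧ x * y ≤ N ^ 2 := by
    intro x y hx hxN hy hyN
    refine ⟨by positivity, ?_⟩
    rw [sq]
    exact mul_le_mul hxN hyN hy.le hN.le
  have ha : |(a : ℝ)| ≤ 2 * (1 + k) := by
    apply hbd a (k * (p₂' * p₂) - p₁' * p₁)
    · rw [hrR, hiR]; ring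
    · have r1 := pr _ _ hp2' h2'.2 hp2 h2.2
      have r2 := pr _ _ hp1' h1'.2 hp1 h1.2
      have r3 := mul_le_mul_of_nonneg_left r1.2 (by positivity : (0 : ℝ) ≤ k)
      have r4 := mul_nonneg (by positivity : (0 : ℝ) ≤ k) r1.1
      have r5 : 0 ≤ (k : ℝ) * N ^ 2 := by positivity
      rw [abs_le]
      constructor <;> linarith [r2.1, r2.2]
  have hb : |(b : ℝ)| ≤ 2 * (1 + k) := by
    apply hbd b (p₁' * p₂ - p₂' * p₁)
    · rw [hrR, hiR]; ring
    · have r1 := pr _ _ hp1' h1'.2 hp2 h2.2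
      have r2 := pr _ _ hp2' h2'.2 hp1 h1.2
      have r5 : 0 ≤ (k : ℝ) * N ^ 2 := by positivity
      rw [abs_le]
      constructor <;> linarith [r2.1, r2.2, r1.1, r1.2]
  have haZ : |a| ≤ 2 * (1 + (k : ℤ)) := by exact_mod_cast ha
  have hbZ : |b| ≤ 2 * (1 + (k : ℤ)) := by exact_mod_cast hb
  have ha1 : a - 1 = 0 := by
    apply Int.eq_zero_of_abs_lt_dvd (m := m)
    · have h : a - 1 = (p₁' - 1) - (p₁ - 1) * a - p₂ * (k * b) := by
        rw [hr]; ring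
      rw [h]
      exact dvd_sub (dvd_sub e1' (e1.mul_right _)) (e2.mul_right _)
    · rw [abs_le] at haZ
      rw [abs_lt]
      constructor <;> linarith
  have hb0 : b = 0 := by
    apply Int.eq_zero_of_abs_lt_dvd (m := m)
    · have h : b = p₂' - p₂ * a - (p₁ - 1) * b := by
        rw [hi]; ring
      rw [h]
      exact dvd_sub (dvd_sub e2' (e2.mul_right _)) (e1.mul_right _)
    · linarith
  have ha1' : a = 1 := by omega
  subst ha1' hb0
  have f1 : p₁ = p₁' := by rw [hr]; ring
  have f2 : p₂ = p₂' := by rw [hi]; ring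
  rw [← f1, ← f2] at hcross
  have := mul_left_cancel₀ hA hcross
  obtain ⟨f3, f4⟩ := hlin _ _ _ _ this
  exact ⟨f1, f2, f3.symm, f4.symm⟩

open Finset in
lemma good_count (k m : ℤ) (hm1 : ∀ d : ℕ, d.Prime → d ≤ 128 → (d : ℤ) ∣ m) (x0 : ℤ) (L : ℕ)
    (hL : 128 ≤ L)
    (hb1 : ∀ x ∈ Ico x0 (x0 + L), (1 + m * x).natAbs < L ^ 3)
    (hb2 : ∀ x ∈ Ico x0 (x0 + L), ∀ y ∈ Ico x0 (x0 + L),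
      ((1 + m * x) ^ 2 - k * (m * y) ^ 2).natAbs < L ^ 3) :
    ∃ G : Finset ((ℤ × ℤ) × (ℤ × ℤ)),
      G ⊆ (Ico x0 (x0 + L) ×ˢ Ico x0 (x0 + L)) ×ˢ (Ico x0 (x0 + L) ×ˢ Ico x0 (x0 + L)) ∧
      (L : ℝ) ^ 4 / 2 ≤ G.card ∧
      ∀ z ∈ G, (∀ d : ℕ, d.Prime →
        ¬ ((d : ℤ) ∣ (1 + m * z.1.1) ^ 2 - k * (m * z.1.2) ^ 2 ∧
          (d : ℤ) ∣ (1 + m * z.2.1) ^ 2 - k * (m * z.2.2) ^ 2)) ∧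
        (∀ d : ℕ, d.Prime → ¬ ((d : ℤ) ∣ 1 + m * z.1.1 ∧ (d : ℤ) ∣ m * z.1.2)) := by
  classical
  set I := Ico x0 (x0 + L) with hI
  have hIc : I.card = L := by simp [hI]
  have hIIc : (I ×ˢ I).card = L * L := by rw [card_product, hIc]
  have nd1 : ∀ d : ℕ, d.Prime → ∀ x : ℤ, (d : ℤ) ∣ 1 + m * x → ¬ (d : ℤ) ∣ m := by
    intro d hd x h1 h2
    have : (d : ℤ) ∣ 1 := (dvd_add_left (h2.mul_right x)).1 h1
    exact (Nat.prime_iff_prime_int.1 hd).not_isUnit (isUnit_of_dvd_one this)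
  have nd2 : ∀ d : ℕ, d.Prime → ∀ x y : ℤ, (d : ℤ) ∣ (1 + m * x) ^ 2 - k * (m * y) ^ 2 →
      ¬ (d : ℤ) ∣ m := by
    intro d hd x y h1 h2
    apply nd1 d hd (2 * x + m * x ^ 2 - k * m * y ^ 2) _ h2
    convert h1 using 1
    ring
  have h2m : (2 : ℤ) ∣ m := by exact_mod_cast hm1 2 Nat.prime_two (by norm_num)
  have nz1 : ∀ x : ℤ, 1 + m * x ≠ 0 := by
    intro x h
    exact nd1 2 Nat.prime_two x (by rw [h]; simp) (by exact_mod_cast h2m)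
  have nz2 : ∀ x y : ℤ, (1 + m * x) ^ 2 - k * (m * y) ^ 2 ≠ 0 := by
    intro x y h
    exact nd2 2 Nat.prime_two x y (by rw [h]; simp) (by exact_mod_cast h2m)
  set B1 := ((I ×ˢ I) ×ˢ (I ×ˢ I)).filter (fun z => ∃ d : ℕ, d.Prime ∧ 128 < d ∧
    (d : ℤ) ∣ (1 + m * z.1.1) ^ 2 - k * (m * z.1.2) ^ 2 ∧
          (d : ℤ) ∣ (1 + m * z.2.1) ^ 2 - k * (m * z.2.2) ^ 2) with hB1
  set B2 := (I ×ˢ I).filter (fun z => ∃ d : ℕ, d.Prime ∧ 128 < d ∧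
    (d : ℤ) ∣ 1 + m * z.1 ∧ (d : ℤ) ∣ z.2) with hB2
  have hLR : (128 : ℝ) ≤ L := by exact_mod_cast hL
  have hL8 : (L : ℝ)⁻¹ ≤ 1 / 128 := by
    rw [inv_le_comm₀ (by linarith) (by norm_num)]
    linarith
  have c1 := bad_count_s5 (I ×ˢ I) (I ×ˢ I) (fun z => (1 + m * z.1) ^ 2 - k * (m * z.2) ^ 2)
    (fun z => (1 + m * z.1) ^ 2 - k * (m * z.2) ^ 2) (L * L) L 128 (by norm_num) (by omega) hIIc
    (fun z hz => ⟨nz2 _ _, hb2 _ (mem_product.1 hz).1 _ (mem_product.1 hz).2⟩)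
    (fun d hd => norm_count k m x0 L d hd) (fun d hd => norm_count k m x0 L d hd)
    B1 (filter_subset _ _) (fun z hz => (mem_filter.1 hz).2)
  have c2 := bad_count_s5 I I (fun x => 1 + m * x) (fun y => y) L L 128 (by norm_num) (by omega) hIc
    (fun z hz => ⟨nz1 _, hb1 _ hz⟩)
    (fun d hd => lin_count m x0 L d hd) (fun d hd => id_count x0 L d hd)
    B2 (filter_subset _ _) (fun z hz => (mem_filter.1 hz).2)
  have c1' : (B1.card : ℝ) ≤ (L : ℝ) ^ 4 / 4 := by
    refine c1.trans ?_
    push_cast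
    have : 8 * ((L : ℝ) * L) ^ 2 / L ≤ 8 * ((L : ℝ) * L) ^ 2 * (1 / 128) := by
      rw [div_eq_mul_inv]
      exact mul_le_mul_of_nonneg_left hL8 (by positivity)
    have h0 : 0 ≤ (L : ℝ) ^ 4 := by positivity
    have e : ((L : ℝ) * L) ^ 2 = L ^ 4 := by ring
    rw [e] at this ⊢
    linarith
  have c2' : (B2.card : ℝ) ≤ (L : ℝ) ^ 2 / 4 := by
    refine c2.trans ?_
    have : 8 * (L : ℝ) ^ 2 / L ≤ 8 * (L : ℝ) ^ 2 * (1 / 128) := by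
      rw [div_eq_mul_inv]
      exact mul_le_mul_of_nonneg_left hL8 (by positivity)
    have h0 : 0 ≤ (L : ℝ) ^ 2 := by positivity
    push_cast
    linarith
  refine ⟨((I ×ˢ I) ×ˢ (I ×ˢ I)) \ (B1 ∪ B2 ×ˢ (I ×ˢ I)), sdiff_subset, ?_, ?_⟩
  · have s1 := le_card_sdiff (B1 ∪ B2 ×ˢ (I ×ˢ I)) ((I ×ˢ I) ×ˢ (I ×ˢ I))
    have s2 := card_union_le B1 (B2 ×ˢ (I ×ˢ I))
    rw [card_product B2, hIIc] at s2
    rw [card_product (I ×ˢ I), hIIc] at s1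
    have s3 : L * L * (L * L) ≤ (((I ×ˢ I) ×ˢ (I ×ˢ I)) \ (B1 ∪ B2 ×ˢ (I ×ˢ I))).card +
      (B1.card + B2.card * (L * L)) := by omega
    have s4 : ((L * L * (L * L) : ℕ) : ℝ) ≤ (((((I ×ˢ I) ×ˢ (I ×ˢ I)) \ (B1 ∪ B2 ×ˢ (I ×ˢ I))).card +
      (B1.card + B2.card * (L * L)) : ℕ) : ℝ) := Nat.cast_le.2 s3
    push_cast at s4
    have s5 : (B2.card : ℝ) * (L * L) ≤ (L : ℝ) ^ 2 / 4 * (L * L) :=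
      mul_le_mul_of_nonneg_right c2' (by positivity)
    have e : (L : ℝ) ^ 2 / 4 * (L * L) = L ^ 4 / 4 := by ring
    have e2 : (L : ℝ) * L * (L * L) = L ^ 4 := by ring
    rw [e] at s5
    rw [e2] at s4
    linarith
  · intro z hz
    rw [mem_sdiff, mem_union, not_or] at hz
    obtain ⟨hz1, hz2, hz3⟩ := hz
    constructor
    · rintro d hd ⟨h1, h2⟩
      apply hz2
      rw [hB1, mem_filter]
      refine ⟨hz1, d, hd, ?_, h1, h2⟩
      by_contra hcon
      exact nd2 d hd _ _ h1 (hm1 d hd (by omega))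
    · rintro d hd ⟨h1, h2⟩
      apply hz3
      rw [mem_product] at hz1 ⊢
      refine ⟨?_, hz1.2⟩
      rw [hB2, mem_filter]
      have hdm := nd1 d hd _ h1
      refine ⟨hz1.1, d, hd, ?_, h1,
        ((Nat.prime_iff_prime_int.1 hd).dvd_or_dvd h2).resolve_left hdm⟩
      by_contra hcon
      exact hdm (hm1 d hd (by omega))

lemma slope_upper (k : ℕ) (M c : ℝ) (hM : 1 ≤ M) :
    (slopeSet k M c).Finite ∧ ((slopeSet k M c).ncard : ℝ) ≤ 625 * M ^ 2 := by
  classical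
  set K : ℕ := ⌊Real.sqrt M⌋₊ with hK
  set J : Finset ℤ := Finset.Icc (-(K : ℤ)) K with hJ
  set F : Finset ℝ := (J ×ˢ J ×ˢ J ×ˢ J).image (fun z =>
    ((z.1 : ℝ) + (z.2.1 : ℝ) * Real.sqrt k) / ((z.2.2.1 : ℝ) + (z.2.2.2 : ℝ) * Real.sqrt k)) with hF
  have hJm : ∀ p : ℤ, |(p : ℝ)| ≤ Real.sqrt M → p ∈ J := by
    intro p hp
    have h1 : p.natAbs ≤ K := by
      rw [hK, Nat.le_floor_iff (Real.sqrt_nonneg _), Nat.cast_natAbs]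
      push_cast
      exact hp
    rw [hJ, Finset.mem_Icc]
    omega
  have hsub : slopeSet k M c ⊆ (F : Set ℝ) := by
    rintro s ⟨p₁, p₂, q₁, q₂, h1, h2, h3, h4, -, -, rfl⟩
    rw [hF]
    simp only [Finset.coe_image, Set.mem_image]
    refine ⟨(p₁, p₂, q₁, q₂), ?_, rfl⟩
    simp only [Finset.coe_product, Set.mem_prod, Finset.mem_coe]
    exact ⟨hJm _ h1.2, hJm _ h2.2, hJm _ h3.2, hJm _ h4.2⟩
  refine ⟨F.finite_toSet.subset hsub, ?_⟩
  have h1 : (slopeSet k M c).ncard ≤ F.card := by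
    rw [← Set.ncard_coe_finset]
    exact Set.ncard_le_ncard hsub F.finite_toSet
  have h2 : F.card ≤ (2 * K + 1) ^ 4 := by
    refine Finset.card_image_le.trans ?_
    have : J.card = 2 * K + 1 := by
      rw [hJ, Int.card_Icc]
      omega
    simp only [Finset.card_product, this]
    apply le_of_eq
    ring
  have h3 : (K : ℝ) ≤ Real.sqrt M := Nat.floor_le (Real.sqrt_nonneg _)
  have h4 : 1 ≤ Real.sqrt M := Real.one_le_sqrt.2 hM
  calc ((slopeSet k M c).ncard : ℝ) ≤ (((2 * K + 1) ^ 4 : ℕ) : ℝ) := by exact_mod_cast h1.trans h2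
    _ = (2 * (K : ℝ) + 1) ^ 4 := by push_cast; ring
    _ ≤ (5 * Real.sqrt M) ^ 4 := pow_le_pow_left₀ (by positivity) (by linarith) 4
    _ = 625 * (Real.sqrt M ^ 2) ^ 2 := by ring
    _ = _ := by rw [Real.sq_sqrt (by linarith)]

lemma slope_lower (k : ℕ) (hks : ¬ IsSquare k) (hk2 : 2 ≤ k) (m : ℕ) (hm : 2 * k + 3 < m)
    (hm1 : ∀ d : ℕ, d.Prime → d ≤ 128 → d ∣ m) (c : ℝ) (hc : 9 / 10 < c) (hc1 : c < 1)
    (M θ : ℝ) (hθ : θ = (1 - c) / (4 * m)) (hM : 1 ≤ M) (hN1 : 128 / θ ≤ Real.sqrt M)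
    (hN2 : k / θ ^ 3 < Real.sqrt M) :
    θ ^ 4 / 2 * M ^ 2 ≤ ((slopeSet k M c).ncard : ℝ) := by
  classical
  set N := Real.sqrt M with hN
  have hm0 : (0 : ℝ) < m := by exact_mod_cast (by omega : 0 < m)
  have hmm1 : (1 : ℝ) ≤ m := by exact_mod_cast (by omega : 1 ≤ m)
  have hθ0 : 0 < θ := by
    rw [hθ]; exact div_pos (by linarith) (by positivity)
  have hθm : 4 * m * θ = 1 - c := by rw [hθ]; field_simp
  have hNpos : 0 < N := by
    rw [hN]; exact Real.sqrt_pos.2 (by linarith)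
  have hN1' : 128 ≤ θ * N := by
    rw [div_le_iff₀ hθ0] at hN1; linarith
  have hN2' : k < θ ^ 3 * N := by
    rw [div_lt_iff₀ (by positivity)] at hN2; linarith
  have hN1one : 1 ≤ N := Real.one_le_sqrt.2 hM
  set L : ℕ := ⌊2 * θ * N⌋₊ with hL
  have hLle : (L : ℝ) ≤ 2 * θ * N := Nat.floor_le (by positivity)
  have hLge : θ * N ≤ L := by
    have := Nat.lt_floor_add_one (2 * θ * N)
    linarith
  have hL128 : 128 ≤ L := by
    have : (128 : ℝ) ≤ L := hN1'.trans hLge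
    exact_mod_cast this
  set x0 : ℤ := ⌈c * N / m⌉ with hx0
  have hcN : 0 < c * N := by positivity
  have hx : ∀ x ∈ Finset.Ico x0 (x0 + L), c * N ≤ m * (x : ℝ) ∧ 1 + m * (x : ℝ) ≤ N := by
    intro x hx
    rw [Finset.mem_Ico] at hx
    have g1 : (x0 : ℝ) ≤ x := by exact_mod_cast hx.1
    have g2 : (x : ℝ) + 1 ≤ x0 + L := by exact_mod_cast hx.2
    have g3 : c * N / m ≤ x0 := Int.le_ceil _
    have g4 : (x0 : ℝ) < c * N / m + 1 := Int.ceil_lt_add_one _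
    have g5 : c * N ≤ m * (x0 : ℝ) := by
      rw [div_le_iff₀ hm0] at g3; linarith
    have g6 : m * (x0 : ℝ) ≤ c * N + m := by
      have := mul_le_mul_of_nonneg_left g4.le hm0.le
      have e : (m : ℝ) * (c * N / m + 1) = c * N + m := by field_simp
      linarith
    refine ⟨g5.trans (mul_le_mul_of_nonneg_left g1 hm0.le), ?_⟩
    have g7 := mul_le_mul_of_nonneg_left g2 hm0.le
    have g8 := mul_le_mul_of_nonneg_left hLle hm0.le
    have g9 : (m : ℝ) * (2 * θ * N) = (1 - c) * N / 2 := by rw [← hθm]; ring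
    have g10 : 2 ≤ (1 - c) * N := by
      have : (1 - c) * N = 4 * (m * (θ * N)) := by rw [← hθm]; ring
      nlinarith
    linarith
  have hL3 : k * N ^ 2 < (L : ℝ) ^ 3 := by
    calc k * N ^ 2 < θ ^ 3 * N * N ^ 2 := mul_lt_mul_of_pos_right hN2' (by positivity)
      _ = (θ * N) ^ 3 := by ring
      _ ≤ _ := pow_le_pow_left₀ (by positivity) hLge 3
  have hk2R : (2 : ℝ) ≤ k := by exact_mod_cast hk2
  have nat_lt : ∀ t : ℤ, |(t : ℝ)| ≤ k * N ^ 2 → t.natAbs < L ^ 3 := by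
    intro t ht
    have : ((t.natAbs : ℕ) : ℝ) < ((L ^ 3 : ℕ) : ℝ) := by
      rw [Nat.cast_natAbs]
      push_cast
      linarith
    exact_mod_cast this
  obtain ⟨G, hGsub, hGc, hG⟩ := good_count (k : ℤ) (m : ℤ)
    (fun d hd h => by exact_mod_cast hm1 d hd h) x0 L hL128
    (by
      intro x hx'
      apply nat_lt
      obtain ⟨g1, g2⟩ := hx x hx'
      push_cast
      rw [abs_of_nonneg (by linarith)]
      nlinarith)
    (by
      intro x hx' y hy'
      apply nat_lt
      obtain ⟨g1, g2⟩ := hx x hx'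
      obtain ⟨g3, g4⟩ := hx y hy'
      push_cast
      have t1 : (1 + m * (x : ℝ)) ^ 2 ≤ N ^ 2 := pow_le_pow_left₀ (by linarith) g2 2
      have t2 : (m * (y : ℝ)) ^ 2 ≤ N ^ 2 := pow_le_pow_left₀ (by linarith) (by linarith) 2
      have t3 := mul_le_mul_of_nonneg_left t2 (by linarith : (0 : ℝ) ≤ k)
      have t4 : 0 ≤ (k : ℝ) * (m * (y : ℝ)) ^ 2 := by positivity
      have t5 : 0 ≤ (1 + m * (x : ℝ)) ^ 2 := by positivity
      have t6 : 2 * N ^ 2 ≤ k * N ^ 2 := mul_le_mul_of_nonneg_right hk2R (by positivity)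
      have t7 : 0 ≤ N ^ 2 := by positivity
      rw [abs_le]
      constructor <;> linarith)
  have hGI : ∀ z ∈ G, z.1.1 ∈ Finset.Ico x0 (x0 + L) ∧ z.1.2 ∈ Finset.Ico x0 (x0 + L) ∧
      z.2.1 ∈ Finset.Ico x0 (x0 + L) ∧ z.2.2 ∈ Finset.Ico x0 (x0 + L) := by
    intro z hz
    have h := hGsub hz
    rw [Finset.mem_product, Finset.mem_product, Finset.mem_product] at h
    exact ⟨h.1.1, h.1.2, h.2.1, h.2.2⟩
  have b1 : ∀ x ∈ Finset.Ico x0 (x0 + L), c * N ≤ ((1 + m * x : ℤ) : ℝ) ∧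
      ((1 + m * x : ℤ) : ℝ) ≤ N := by
    intro x hx'
    obtain ⟨g1, g2⟩ := hx x hx'
    push_cast
    constructor <;> linarith
  have b2 : ∀ x ∈ Finset.Ico x0 (x0 + L), c * N ≤ ((m * x : ℤ) : ℝ) ∧
      ((m * x : ℤ) : ℝ) ≤ N := by
    intro x hx'
    obtain ⟨g1, g2⟩ := hx x hx'
    push_cast
    constructor <;> linarith
  have hab : ∀ t : ℤ, (c * N ≤ (t : ℝ) ∧ (t : ℝ) ≤ N) → c * N ≤ |(t : ℝ)| ∧ |(t : ℝ)| ≤ N := by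
    intro t ht
    rw [abs_of_nonneg (hcN.le.trans ht.1)]
    exact ht
  set φ : (ℤ × ℤ) × (ℤ × ℤ) → ℝ := fun z =>
    (((1 + m * z.1.1 : ℤ) : ℝ) + ((m * z.1.2 : ℤ) : ℝ) * Real.sqrt k) /
      (((1 + m * z.2.1 : ℤ) : ℝ) + ((m * z.2.2 : ℤ) : ℝ) * Real.sqrt k) with hφ
  have hinj : Set.InjOn φ (G : Set ((ℤ × ℤ) × (ℤ × ℤ))) := by
    intro z hz w hw hzw
    have hz' := hGI z hz
    have hw' := hGI w hw
    have hcop : IsCoprime ((1 + m * z.1.1 : ℤ) ^ 2 - (k : ℤ) * (m * z.1.2 : ℤ) ^ 2)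
        ((1 + m * z.2.1 : ℤ) ^ 2 - (k : ℤ) * (m * z.2.2 : ℤ) ^ 2) := by
      rw [Int.isCoprime_iff_gcd_eq_one]
      by_contra hcon
      obtain ⟨d, hd, hdd⟩ := Nat.exists_prime_and_dvd hcon
      apply (hG z hz).1 d hd
      have := Int.natCast_dvd_natCast.2 hdd
      exact ⟨this.trans (Int.gcd_dvd_left _ _), this.trans (Int.gcd_dvd_right _ _)⟩
    obtain ⟨r1, r2, r3, r4⟩ := slope_inj k hks hk2 (m : ℤ) (by exact_mod_cast hm) N hNpos c hc
      _ _ _ _ _ _ _ _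
      (b1 _ hz'.1) (b2 _ hz'.2.1) (b1 _ hz'.2.2.1) (b2 _ hz'.2.2.2)
      (b1 _ hw'.1) (b2 _ hw'.2.1) (b1 _ hw'.2.2.1) (b2 _ hw'.2.2.2)
      ⟨z.1.1, by ring⟩ ⟨z.1.2, rfl⟩ ⟨w.1.1, by ring⟩ ⟨w.1.2, rfl⟩ hcop hzw
    have hmz : (m : ℤ) ≠ 0 := by omega
    have r1' := mul_left_cancel₀ hmz (add_left_cancel r1)
    have r2' := mul_left_cancel₀ hmz r2
    have r3' := mul_left_cancel₀ hmz (add_left_cancel r3)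
    have r4' := mul_left_cancel₀ hmz r4
    exact Prod.ext (Prod.ext r1' r2') (Prod.ext r3' r4')
  have hmem : ((G.image φ : Finset ℝ) : Set ℝ) ⊆ slopeSet k M c := by
    intro s hs
    rw [Finset.coe_image] at hs
    obtain ⟨z, hz, rfl⟩ := hs
    have hz' := hGI z hz
    refine ⟨1 + m * z.1.1, m * z.1.2, 1 + m * z.2.1, m * z.2.2, hab _ (b1 _ hz'.1),
      hab _ (b2 _ hz'.2.1), hab _ (b1 _ hz'.2.2.1), hab _ (b2 _ hz'.2.2.2), ?_, ?_, rfl⟩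
    · rintro ⟨d, hd, -, h1, h2⟩
      exact (hG z hz).1 d hd ⟨h1, h2⟩
    · rintro ⟨d, hd, -, h1, h2⟩
      exact (hG z hz).2 d hd ⟨h1, h2⟩
  have hcard : G.card ≤ (slopeSet k M c).ncard := by
    rw [← Finset.card_image_of_injOn hinj, ← Set.ncard_coe_finset]
    exact Set.ncard_le_ncard hmem (slope_upper k M c hM).1
  calc θ ^ 4 / 2 * M ^ 2 = (θ * N) ^ 4 / 2 := by
        have : M = N ^ 2 := (Real.sq_sqrt (by linarith)).symm
        rw [this]; ring
    _ ≤ (L : ℝ) ^ 4 / 2 := by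
        have := pow_le_pow_left₀ (by positivity) hLge 4
        linarith
    _ ≤ G.card := hGc
    _ ≤ _ := by exact_mod_cast hcard

/-- Size of the slope set: `|S| = Θ(M²)`. -/
theorem slope_set_size (k : ℕ) (hk : 0 < k) (hks : ¬ IsSquare k) :
    ∃ cstar : ℝ, 0 < cstar ∧ cstar < 1 ∧
      ∀ c : ℝ, cstar < c → c < 1 →
        ∃ c₁ C₁ M₀ : ℝ, 0 < c₁ ∧ 0 < C₁ ∧
          ∀ M : ℝ, M₀ ≤ M →
            c₁ * M ^ 2 ≤ ((slopeSet k M c).ncard : ℝ) ∧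
            ((slopeSet k M c).ncard : ℝ) ≤ C₁ * M ^ 2 := by
  have hk2 : 2 ≤ k := by
    by_contra h
    have : k = 1 := by omega
    exact hks ⟨1, by omega⟩
  obtain ⟨m, hm, hm1⟩ : ∃ m : ℕ, 2 * k + 3 < m ∧ ∀ d : ℕ, d.Prime → d ≤ 128 → d ∣ m := by
    refine ⟨(2 * k + 4) * Nat.factorial 128, ?_, ?_⟩
    · have := Nat.factorial_pos 128
      calc 2 * k + 3 < (2 * k + 4) * 1 := by omega
        _ ≤ _ := Nat.mul_le_mul_left _ this
    · intro d hd h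
      exact (Nat.dvd_factorial hd.pos h).mul_left _
  refine ⟨9 / 10, by norm_num, by norm_num, ?_⟩
  intro c hc hc1
  have hm0 : (0 : ℝ) < m := by exact_mod_cast (by omega : 0 < m)
  obtain ⟨θ, hθ⟩ : ∃ θ : ℝ, θ = (1 - c) / (4 * m) := ⟨_, rfl⟩
  have hθ0 : 0 < θ := by
    rw [hθ]; exact div_pos (by linarith) (by positivity)
  obtain ⟨R, hR⟩ : ∃ R : ℝ, R = 1 + 128 / θ + k / θ ^ 3 := ⟨_, rfl⟩
  have ha : 0 < 128 / θ := by positivity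
  have hb : 0 ≤ k / θ ^ 3 := by positivity
  refine ⟨θ ^ 4 / 2, 625, R ^ 2, by positivity, by norm_num, ?_⟩
  intro M hM
  have hR1 : 1 ≤ R := by linarith
  have hM1 : 1 ≤ M := le_trans (by nlinarith) hM
  have hs : R ≤ Real.sqrt M := Real.le_sqrt_of_sq_le hM
  exact ⟨slope_lower k hks hk2 m hm hm1 c hc hc1 M θ hθ hM1 (by linarith) (by linarith),
    (slope_upper k M c hM1).2⟩
end
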